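/- Let (M,𝒳) ⊨ RCA0, ℱ the class of total functions M→M in 𝒳, and 𝒰 an ultrafilter on 𝒳 all of whose elements are cofinal in M. For n ∈ ℕ, if (M,𝒳) satisfies Σ_n-comprehension, then M ≼_{Σ_{n+2}} ℱ/𝒰 as models of first-order arithmetic: every first-order Σ_{n+2} formula with parameters from M is absolute between M and the restricted ultrapower ℱ/𝒰. -/

import Mathlib

namespace PaperArith

/-! ## Syntax of (two-sorted) first-order arithmetic

Terms and formulas of arithmetic in the language `{0, 1, +, ·, <}`,
with number variables and (monadic second-order) set variables both indexed
by natural numbers.  Bounded quantifiers are taken as primitives, so that the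
class `Δ₀` of bounded formulas is a purely syntactic class. -/

/-- Terms of first-order arithmetic in the language `{0, 1, +, ·, <}`. -/
inductive Term : Type
  | var : ℕ → Term
  | zero : Term
  | one : Term
  | add : Term → Term → Term
  | mul : Term → Term → Term

/-- Formulas of (two-sorted) arithmetic.  `mem t i` is the atomic formula
`t ∈ Xᵢ`; `ball x t φ` is `∀ x < t, φ` and `bex x t φ` is `∃ x < t, φ`;
`sall i φ` and `sex i φ` quantify over the set variable `Xᵢ`.
Purely first-order formulas are those avoiding `mem`, `sall`, `sex`. -/
inductive Fml : Type
  | eq : Term → Term → Fml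
  | lt : Term → Term → Fml
  | mem : Term → ℕ → Fml
  | not : Fml → Fml
  | and : Fml → Fml → Fml
  | or : Fml → Fml → Fml
  | imp : Fml → Fml → Fml
  | all : ℕ → Fml → Fml
  | ex : ℕ → Fml → Fml
  | ball : ℕ → Term → Fml → Fml
  | bex : ℕ → Term → Fml → Fml
  | sall : ℕ → Fml → Fml
  | sex : ℕ → Fml → Fml

/-- A structure for the first-order language of arithmetic. -/
structure Str : Type 1 where
  M : Type
  zero : M
  one : M
  add : M → M → M
  mul : M → M → M
  lt : M → M → Prop

/-- Value of a term under a valuation of the number variables. -/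
def tval (S : Str) (v : ℕ → S.M) : Term → S.M
  | .var i => v i
  | .zero => S.zero
  | .one => S.one
  | .add t u => S.add (tval S v t) (tval S v u)
  | .mul t u => S.mul (tval S v t) (tval S v u)

/-- Update a valuation at one variable. -/
def upd {α : Type} (v : ℕ → α) (x : ℕ) (a : α) : ℕ → α :=
  fun i => if i = x then a else v i

/-- Tarskian satisfaction over the structure `S`, with second-order universe
`X` (set quantifiers range over `X`); `v` is the valuation of number
variables, `w` the valuation of set variables. -/
def Sat (S : Str) (X : Set (Set S.M)) : (ℕ → S.M) → (ℕ → Set S.M) → Fml → Prop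
  | v, _, .eq t u => tval S v t = tval S v u
  | v, _, .lt t u => S.lt (tval S v t) (tval S v u)
  | v, w, .mem t i => tval S v t ∈ w i
  | v, w, .not φ => ¬ Sat S X v w φ
  | v, w, .and φ ψ => Sat S X v w φ ∧ Sat S X v w ψ
  | v, w, .or φ ψ => Sat S X v w φ ∨ Sat S X v w ψ
  | v, w, .imp φ ψ => Sat S X v w φ → Sat S X v w ψ
  | v, w, .all x φ => ∀ m : S.M, Sat S X (upd v x m) w φ
  | v, w, .ex x φ => ∃ m : S.M, Sat S X (upd v x m) w φ
  | v, w, .ball x t φ => ∀ m : S.M, S.lt m (tval S v t) → Sat S X (upd v x m) w φ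
  | v, w, .bex x t φ => ∃ m : S.M, S.lt m (tval S v t) ∧ Sat S X (upd v x m) w φ
  | v, w, .sall i φ => ∀ A : Set S.M, A ∈ X → Sat S X v (upd w i A) φ
  | v, w, .sex i φ => ∃ A : Set S.M, A ∈ X ∧ Sat S X v (upd w i A) φ

/-- First-order satisfaction (for purely first-order formulas the second-order
data is irrelevant). -/
def Sat0 (S : Str) (v : ℕ → S.M) (φ : Fml) : Prop :=
  Sat S ∅ v (fun _ => ∅) φ

/-! ## The arithmetic hierarchy -/

/-- `Δ₀` formulas: purely first-order, only bounded quantifiers. -/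
inductive Delta0 : Fml → Prop
  | eq (t u : Term) : Delta0 (.eq t u)
  | lt (t u : Term) : Delta0 (.lt t u)
  | not {φ : Fml} : Delta0 φ → Delta0 (.not φ)
  | and {φ ψ : Fml} : Delta0 φ → Delta0 ψ → Delta0 (.and φ ψ)
  | or {φ ψ : Fml} : Delta0 φ → Delta0 ψ → Delta0 (.or φ ψ)
  | imp {φ ψ : Fml} : Delta0 φ → Delta0 ψ → Delta0 (.imp φ ψ)
  | ball (x : ℕ) (t : Term) {φ : Fml} : Delta0 φ → Delta0 (.ball x t φ)
  | bex (x : ℕ) (t : Term) {φ : Fml} : Delta0 φ → Delta0 (.bex x t φ)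

mutual
  /-- `Σₙ` formulas of the first-order arithmetic hierarchy. -/
  inductive IsSigma : ℕ → Fml → Prop
    | delta0 {n : ℕ} {φ : Fml} : Delta0 φ → IsSigma n φ
    | ofPi {n : ℕ} {φ : Fml} : IsPi n φ → IsSigma (n + 1) φ
    | ex (x : ℕ) {n : ℕ} {φ : Fml} : IsSigma (n + 1) φ → IsSigma (n + 1) (.ex x φ)
  /-- `Πₙ` formulas of the first-order arithmetic hierarchy. -/
  inductive IsPi : ℕ → Fml → Prop
    | delta0 {n : ℕ} {φ : Fml} : Delta0 φ → IsPi n φ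
    | ofSigma {n : ℕ} {φ : Fml} : IsSigma n φ → IsPi (n + 1) φ
    | all (x : ℕ) {n : ℕ} {φ : Fml} : IsPi (n + 1) φ → IsPi (n + 1) (.all x φ)
end

/-- `Σ₀(Σₙ)`: the closure of `Σₙ` under Boolean operations and bounded
quantification. -/
inductive Sigma0Sigma (n : ℕ) : Fml → Prop
  | ofSigma {φ : Fml} : IsSigma n φ → Sigma0Sigma n φ
  | not {φ : Fml} : Sigma0Sigma n φ → Sigma0Sigma n (.not φ)
  | and {φ ψ : Fml} : Sigma0Sigma n φ → Sigma0Sigma n ψ → Sigma0Sigma n (.and φ ψ)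
  | or {φ ψ : Fml} : Sigma0Sigma n φ → Sigma0Sigma n ψ → Sigma0Sigma n (.or φ ψ)
  | imp {φ ψ : Fml} : Sigma0Sigma n φ → Sigma0Sigma n ψ → Sigma0Sigma n (.imp φ ψ)
  | ball (x : ℕ) (t : Term) {φ : Fml} : Sigma0Sigma n φ → Sigma0Sigma n (.ball x t φ)
  | bex (x : ℕ) (t : Term) {φ : Fml} : Sigma0Sigma n φ → Sigma0Sigma n (.bex x t φ)

/-- The class `Σₙ ∧ Πₙ` of conjunctions of a `Σₙ` and a `Πₙ` formula. -/
def SigmaAndPi (n : ℕ) (φ : Fml) : Prop :=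
  ∃ ψ χ : Fml, IsSigma n ψ ∧ IsPi n χ ∧ φ = Fml.and ψ χ

/-- The class `Σₙ ∨ Πₙ` of disjunctions of a `Σₙ` and a `Πₙ` formula. -/
def SigmaOrPi (n : ℕ) (φ : Fml) : Prop :=
  ∃ ψ χ : Fml, IsSigma n ψ ∧ IsPi n χ ∧ φ = Fml.or ψ χ

/-- `Δ₀⁰` formulas of second-order arithmetic: only bounded first-order
quantifiers; free set variables (set parameters) are allowed. -/
inductive Delta0SO : Fml → Prop
  | eq (t u : Term) : Delta0SO (.eq t u)
  | lt (t u : Term) : Delta0SO (.lt t u)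
  | mem (t : Term) (i : ℕ) : Delta0SO (.mem t i)
  | not {φ : Fml} : Delta0SO φ → Delta0SO (.not φ)
  | and {φ ψ : Fml} : Delta0SO φ → Delta0SO ψ → Delta0SO (.and φ ψ)
  | or {φ ψ : Fml} : Delta0SO φ → Delta0SO ψ → Delta0SO (.or φ ψ)
  | imp {φ ψ : Fml} : Delta0SO φ → Delta0SO ψ → Delta0SO (.imp φ ψ)
  | ball (x : ℕ) (t : Term) {φ : Fml} : Delta0SO φ → Delta0SO (.ball x t φ)
  | bex (x : ℕ) (t : Term) {φ : Fml} : Delta0SO φ → Delta0SO (.bex x t φ)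

mutual
  /-- `Σₙ⁰` formulas of the second-order arithmetic hierarchy
  (set parameters allowed, no set quantifiers). -/
  inductive SigmaSO : ℕ → Fml → Prop
    | delta0 {n : ℕ} {φ : Fml} : Delta0SO φ → SigmaSO n φ
    | ofPi {n : ℕ} {φ : Fml} : PiSO n φ → SigmaSO (n + 1) φ
    | ex (x : ℕ) {n : ℕ} {φ : Fml} : SigmaSO (n + 1) φ → SigmaSO (n + 1) (.ex x φ)
  /-- `Πₙ⁰` formulas of the second-order arithmetic hierarchy. -/
  inductive PiSO : ℕ → Fml → Prop
    | delta0 {n : ℕ} {φ : Fml} : Delta0SO φ → PiSO n φ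
    | ofSigma {n : ℕ} {φ : Fml} : SigmaSO n φ → PiSO (n + 1) φ
    | all (x : ℕ) {n : ℕ} {φ : Fml} : PiSO (n + 1) φ → PiSO (n + 1) (.all x φ)
end

/-! ## First-order theories -/

/-- `PA⁻`: the theory of non-negative parts of discretely ordered rings. -/
structure PAminus (S : Str) : Prop where
  add_assoc : ∀ a b c, S.add (S.add a b) c = S.add a (S.add b c)
  add_comm : ∀ a b, S.add a b = S.add b a
  mul_assoc : ∀ a b c, S.mul (S.mul a b) c = S.mul a (S.mul b c)
  mul_comm : ∀ a b, S.mul a b = S.mul b a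
  distrib : ∀ a b c, S.mul a (S.add b c) = S.add (S.mul a b) (S.mul a c)
  add_zero : ∀ a, S.add a S.zero = a
  mul_zero : ∀ a, S.mul a S.zero = S.zero
  mul_one : ∀ a, S.mul a S.one = a
  lt_irrefl : ∀ a, ¬ S.lt a a
  lt_trans : ∀ a b c, S.lt a b → S.lt b c → S.lt a c
  lt_total : ∀ a b, S.lt a b ∨ a = b ∨ S.lt b a
  add_lt_add : ∀ a b c, S.lt a b → S.lt (S.add a c) (S.add b c)
  mul_lt_mul : ∀ a b c, S.lt a b → S.lt S.zero c → S.lt (S.mul a c) (S.mul b c)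
  zero_lt_one : S.lt S.zero S.one
  zero_le : ∀ a, a = S.zero ∨ S.lt S.zero a
  discrete : ∀ a b, S.lt a b → S.add a S.one = b ∨ S.lt (S.add a S.one) b
  pred : ∀ a, S.lt S.zero a → ∃ b, S.add b S.one = a
  sub : ∀ a b, S.lt a b → ∃ c, S.add a c = b

/-- The induction scheme for the class `Γ` of formulas
(parameters are allowed via the ambient valuation `v`). -/
def IndFor (S : Str) (Γ : Fml → Prop) : Prop :=
  ∀ φ : Fml, Γ φ → ∀ (v : ℕ → S.M) (x : ℕ),
    Sat0 S (upd v x S.zero) φ →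
    (∀ m, Sat0 S (upd v x m) φ → Sat0 S (upd v x (S.add m S.one)) φ) →
    ∀ m, Sat0 S (upd v x m) φ

/-- The collection scheme for the class `Γ`:
`(∀ x < a ∃ y φ) → (∃ b ∀ x < a ∃ y < b φ)`. -/
def CollFor (S : Str) (Γ : Fml → Prop) : Prop :=
  ∀ φ : Fml, Γ φ → ∀ (v : ℕ → S.M) (x y : ℕ), x ≠ y → ∀ a : S.M,
    (∀ m, S.lt m a → ∃ k, Sat0 S (upd (upd v x m) y k) φ) →
    ∃ b, ∀ m, S.lt m a → ∃ k, S.lt k b ∧ Sat0 S (upd (upd v x m) y k) φ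

/-- `IΔ₀` (over `PA⁻`). -/
def IDelta0 (S : Str) : Prop := PAminus S ∧ IndFor S Delta0

/-- `IΣₙ` (over `PA⁻`; note `Δ₀ ⊆ Σₙ`, so this includes `IΔ₀`). -/
def ISigma (S : Str) (n : ℕ) : Prop := PAminus S ∧ IndFor S (IsSigma n)

/-- `BΣₙ`: the `Σₙ`-collection scheme, including `IΔ₀` (over `PA⁻`). -/
def BSigma (S : Str) (n : ℕ) : Prop := IDelta0 S ∧ CollFor S (IsSigma n)

/-- The weak regularity principle `WRφ` for all `φ` in the class `Γ`:
the universal closure of `(∀ x ∃ y < a φ(x,y)) → (∃ y < a ∀ b ∃ x > b φ(x,y))`.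
Here `x, y` are the two displayed variables and all other free variables of
`φ` are parameters, interpreted by the ambient valuation `v`. -/
def WRFor (S : Str) (Γ : Fml → Prop) : Prop :=
  ∀ φ : Fml, Γ φ → ∀ (v : ℕ → S.M) (x y : ℕ), x ≠ y → ∀ a : S.M,
    (∀ m, ∃ k, S.lt k a ∧ Sat0 S (upd (upd v x m) y k) φ) →
    ∃ k, S.lt k a ∧ ∀ b, ∃ m, S.lt b m ∧ Sat0 S (upd (upd v x m) y k) φ

/-! ## Second-order theories -/

/-- Second-order induction scheme for the class `Γ`, with set parameters
from the second-order universe `X`. -/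
def IndForSO (S : Str) (X : Set (Set S.M)) (Γ : Fml → Prop) : Prop :=
  ∀ φ : Fml, Γ φ → ∀ (v : ℕ → S.M) (w : ℕ → Set S.M), (∀ i, w i ∈ X) → ∀ x : ℕ,
    Sat S X (upd v x S.zero) w φ →
    (∀ m, Sat S X (upd v x m) w φ → Sat S X (upd v x (S.add m S.one)) w φ) →
    ∀ m, Sat S X (upd v x m) w φ

/-- Second-order collection scheme for the class `Γ`. -/
def CollForSO (S : Str) (X : Set (Set S.M)) (Γ : Fml → Prop) : Prop :=
  ∀ φ : Fml, Γ φ → ∀ (v : ℕ → S.M) (w : ℕ → Set S.M), (∀ i, w i ∈ X) →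
    ∀ (x y : ℕ), x ≠ y → ∀ a : S.M,
    (∀ m, S.lt m a → ∃ k, Sat S X (upd (upd v x m) y k) w φ) →
    ∃ b, ∀ m, S.lt m a → ∃ k, S.lt k b ∧ Sat S X (upd (upd v x m) y k) w φ

/-- `Δ₁⁰`-comprehension. -/
def Delta1CA (S : Str) (X : Set (Set S.M)) : Prop :=
  ∀ φ ψ : Fml, SigmaSO 1 φ → PiSO 1 ψ →
    ∀ (v : ℕ → S.M) (w : ℕ → Set S.M), (∀ i, w i ∈ X) → ∀ x : ℕ,
    (∀ m, Sat S X (upd v x m) w φ ↔ Sat S X (upd v x m) w ψ) →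
    ∃ A ∈ X, ∀ m, m ∈ A ↔ Sat S X (upd v x m) w φ

/-- `Σₙ`-comprehension for first-order formulas with parameters from `M`. -/
def SigmaCA (S : Str) (X : Set (Set S.M)) (n : ℕ) : Prop :=
  ∀ φ : Fml, IsSigma n φ → ∀ (v : ℕ → S.M) (x : ℕ),
    ∃ A ∈ X, ∀ m, m ∈ A ↔ Sat0 S (upd v x m) φ

/-- `RCA₀`. -/
def RCA0 (S : Str) (X : Set (Set S.M)) : Prop :=
  PAminus S ∧ IndForSO S X (SigmaSO 1) ∧ Delta1CA S X

/-- `Σ₁⁰`-separation; over `RCA₀` this is equivalent to weak Kőnig's lemma. -/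
def Sigma1Sep (S : Str) (X : Set (Set S.M)) : Prop :=
  ∀ φ ψ : Fml, SigmaSO 1 φ → SigmaSO 1 ψ →
    ∀ (v : ℕ → S.M) (w : ℕ → Set S.M), (∀ i, w i ∈ X) → ∀ x : ℕ,
    (∀ m, ¬ (Sat S X (upd v x m) w φ ∧ Sat S X (upd v x m) w ψ)) →
    ∃ A ∈ X, ∀ m, (Sat S X (upd v x m) w φ → m ∈ A) ∧ (m ∈ A → ¬ Sat S X (upd v x m) w ψ)

/-- `WKL₀`, rendered as `RCA₀` plus `Σ₁⁰`-separation (which is equivalent,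
over `RCA₀`, to weak Kőnig's lemma). -/
def WKL0 (S : Str) (X : Set (Set S.M)) : Prop := RCA0 S X ∧ Sigma1Sep S X

/-- `BΣₙ⁰`: the second-order `Σₙ⁰`-collection scheme (including `IΔ₀⁰`,
over `PA⁻`). -/
def BSigmaSO (S : Str) (X : Set (Set S.M)) (n : ℕ) : Prop :=
  PAminus S ∧ IndForSO S X Delta0SO ∧ CollForSO S X (SigmaSO n)

/-- `IΣₙ⁰`: the second-order `Σₙ⁰`-induction scheme, over `RCA₀`. -/
def ISigmaSO (S : Str) (X : Set (Set S.M)) (n : ℕ) : Prop :=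
  RCA0 S X ∧ IndForSO S X (SigmaSO n)

/-! ## Exponentiation and binary digits -/

/-- Satisfaction of a three-variable formula `E(x₀, x₁, x₂)` at `(a, b, c)`. -/
def ExpAt (S : Str) (E : Fml) (a b c : S.M) : Prop :=
  Sat0 S (fun i => if i = 0 then a else if i = 1 then b else c) E

/-- `E(x₀,x₁,x₂)` is a `Δ₀` definition of the (total) exponentiation function
`x₀ ^ x₁ = x₂`.  The existence of such an `E` expresses `exp`
(the totality of exponentiation). -/
structure IsExpDef (S : Str) (E : Fml) : Prop where
  delta0 : Delta0 E
  base : ∀ a, ExpAt S E a S.zero S.one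
  total : ∀ a b, ∃ c, ExpAt S E a b c
  unique : ∀ a b c c', ExpAt S E a b c → ExpAt S E a b c' → c = c'
  step : ∀ a b c, ExpAt S E a b c → ExpAt S E a (S.add b S.one) (S.mul c a)

/-- `exp`: the totality of exponentiation (via a `Δ₀` definition of its
graph). -/
def SatExp (S : Str) : Prop := ∃ E : Fml, IsExpDef S E

/-! ## Embeddings, end extensions and elementarity -/

/-- An embedding of arithmetic structures. -/
structure Emb (S K : Str) where
  j : S.M → K.M
  inj : Function.Injective j
  zero : j S.zero = K.zero
  one : j S.one = K.one
  add : ∀ a b, j (S.add a b) = K.add (j a) (j b)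
  mul : ∀ a b, j (S.mul a b) = K.mul (j a) (j b)
  lt_iff : ∀ a b, S.lt a b ↔ K.lt (j a) (j b)

/-- The extension along `e` is an end extension: every element of `K` not in
the image of `M` exceeds every element of `M`. -/
def IsEndExt {S K : Str} (e : Emb S K) : Prop :=
  ∀ b : K.M, b ∉ Set.range e.j → ∀ a : S.M, K.lt (e.j a) b

/-- The extension along `e` is proper. -/
def IsProper {S K : Str} (e : Emb S K) : Prop := ¬ Function.Surjective e.j

/-- The extension along `e` is `Σₙ`-elementary: all `Σₙ` formulas with
parameters from `M` are absolute between `M` and `K`. -/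
def SigmaElem {S K : Str} (e : Emb S K) (n : ℕ) : Prop :=
  ∀ φ : Fml, IsSigma n φ → ∀ v : ℕ → S.M,
    (Sat0 S v φ ↔ Sat0 K (fun i => e.j (v i)) φ)

/-- `K ⊨ M‑IΣₙ` (for an extension `e : M → K`): induction up to any `a ∈ M`
for `Σₙ` formulas with parameters from `K`. -/
def MISigma {S K : Str} (e : Emb S K) (n : ℕ) : Prop :=
  ∀ φ : Fml, IsSigma n φ → ∀ (v : ℕ → K.M) (x : ℕ) (a : S.M),
    Sat0 K (upd v x K.zero) φ →
    (∀ m, K.lt m (e.j a) → (Sat0 K (upd v x m) φ → Sat0 K (upd v x (K.add m K.one)) φ)) →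
    ∀ m, K.lt m (e.j a) → Sat0 K (upd v x m) φ

/-- The `x`-th binary digit of `c ∈ K` is `1`, computed via a `Δ₀` definition
`E` of exponentiation on the ground model `S` (here `x` lies under the image
of `S`): there are `x', p ∈ M` with `j x' = x`, `p = 2 ^ x'`, and `u, v ∈ K`
with `c = u·(2p) + p + v` and `v < p`. -/
def BitVia {S K : Str} (e : Emb S K) (E : Fml) (x c : K.M) : Prop :=
  ∃ x' p : S.M, e.j x' = x ∧ ExpAt S E (S.add S.one S.one) x' p ∧
    ∃ u v : K.M, K.lt v (e.j p) ∧
      c = K.add (K.add (K.mul u (K.add (e.j p) (e.j p))) (e.j p)) v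

/-! ## The second-order restricted ultrapower -/

/-- `A` is cofinal (unbounded) in `S`. -/
def Cofinal (S : Str) (A : Set S.M) : Prop := ∀ b : S.M, ∃ x ∈ A, S.lt b x

/-- The pairing term `⟨x, y⟩ = (x + y)·(x + y) + x`. -/
def pairS (S : Str) (x y : S.M) : S.M := S.add (S.mul (S.add x y) (S.add x y)) x

/-- The graph of `f : M → M`, coded as a subset of `M` via pairing. -/
def graphOf (S : Str) (f : S.M → S.M) : Set S.M := {m | ∃ x, m = pairS S x (f x)}

/-- `f` is a total function `M → M` lying in the second-order universe `X`
(its coded graph belongs to `X`).  The collection of such `f` is the class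
`ℱ` of the restricted ultrapower. -/
def FuncIn (S : Str) (X : Set (Set S.M)) (f : S.M → S.M) : Prop := graphOf S f ∈ X

/-- `U` is an ultrafilter on the Boolean algebra `X`, all of whose elements
are cofinal in `M`. -/
structure UltraOn (S : Str) (X U : Set (Set S.M)) : Prop where
  subset : U ⊆ X
  univ_mem : Set.univ ∈ U
  empty_not_mem : ∅ ∉ U
  inter_mem : ∀ A ∈ U, ∀ B ∈ U, A ∩ B ∈ U
  superset_mem : ∀ A ∈ U, ∀ B ∈ X, A ⊆ B → B ∈ U
  ultra : ∀ A ∈ X, A ∈ U ∨ Aᶜ ∈ U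
  cofinal : ∀ A ∈ U, Cofinal S A

/-- A realization of the second-order restricted ultrapower `ℱ/𝒰` of `S`
with respect to the second-order universe `X` and the ultrafilter `U`:
a structure `K` whose elements are exactly the classes `cls f hf = [f]` of
total functions `f ∈ ℱ`, where `[f] = [g]` iff `f = g` on a set in `U`, with
pointwise arithmetic operations, order decided by `U`, and the inherited
second-order membership relation `memK` serving as the second-order expansion. -/
structure RUP (S : Str) (X U : Set (Set S.M)) : Type 1 where
  K : Str
  cls : (f : S.M → S.M) → FuncIn S X f → K.M
  memK : K.M → Set S.M → Prop
  const_in : ∀ a : S.M, FuncIn S X (fun _ => a)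
  surj : ∀ b : K.M, ∃ (f : S.M → S.M) (hf : FuncIn S X f), cls f hf = b
  eq_iff : ∀ (f : S.M → S.M) (hf : FuncIn S X f) (g : S.M → S.M) (hg : FuncIn S X g),
      (cls f hf = cls g hg) ↔ {i : S.M | f i = g i} ∈ U
  lt_iff : ∀ (f : S.M → S.M) (hf : FuncIn S X f) (g : S.M → S.M) (hg : FuncIn S X g),
      K.lt (cls f hf) (cls g hg) ↔ {i : S.M | S.lt (f i) (g i)} ∈ U
  zero_eq : K.zero = cls (fun _ => S.zero) (const_in S.zero)
  one_eq : K.one = cls (fun _ => S.one) (const_in S.one)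
  add_eq : ∀ (f : S.M → S.M) (hf : FuncIn S X f) (g : S.M → S.M) (hg : FuncIn S X g)
      (h : S.M → S.M) (hh : FuncIn S X h), (∀ i, h i = S.add (f i) (g i)) →
      K.add (cls f hf) (cls g hg) = cls h hh
  mul_eq : ∀ (f : S.M → S.M) (hf : FuncIn S X f) (g : S.M → S.M) (hg : FuncIn S X g)
      (h : S.M → S.M) (hh : FuncIn S X h), (∀ i, h i = S.mul (f i) (g i)) →
      K.mul (cls f hf) (cls g hg) = cls h hh
  mem_iff : ∀ (f : S.M → S.M) (hf : FuncIn S X f) (A : Set S.M), A ∈ X →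
      (memK (cls f hf) A ↔ {i : S.M | f i ∈ A} ∈ U)

/-- The canonical embedding `M → ℱ/𝒰` via constant functions. -/
def RUP.emb {S : Str} {X U : Set (Set S.M)} (R : RUP S X U) (a : S.M) : R.K.M :=
  R.cls (fun _ => a) (R.const_in a)

/-- The subset of `ℱ/𝒰` induced by `A ⊆ M`. -/
def RUP.setImg {S : Str} {X U : Set (Set S.M)} (R : RUP S X U) (A : Set S.M) :
    Set R.K.M := {b | R.memK b A}

/-- The second-order part of the expanded ultrapower `(ℱ/𝒰, 𝒳)`:
the (injected) copy of `X`. -/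
def RUP.X2 {S : Str} {X U : Set (Set S.M)} (R : RUP S X U) : Set (Set R.K.M) :=
  (fun A => R.setImg A) '' X

end PaperArith

namespace PaperArith

/-! ## Order and pairing in `PA⁻` -/

section Pairing

variable {S : Str}

/-- The commutative semiring underlying a model of `PA⁻`. -/
abbrev PAminus.commSemiring (h : PAminus S) : CommSemiring S.M where
  add := S.add
  add_assoc := h.add_assoc
  zero := S.zero
  zero_add a := (h.add_comm S.zero a).trans (h.add_zero a)
  add_zero := h.add_zero
  add_comm := h.add_comm
  nsmul := @nsmulRec _ ⟨S.zero⟩ ⟨S.add⟩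
  mul := S.mul
  left_distrib := h.distrib
  right_distrib a b c := by
    change S.mul (S.add a b) c = S.add (S.mul a c) (S.mul b c)
    rw [h.mul_comm, h.distrib, h.mul_comm c a, h.mul_comm c b]
  zero_mul a := (h.mul_comm S.zero a).trans (h.mul_zero a)
  mul_zero := h.mul_zero
  mul_assoc := h.mul_assoc
  one := S.one
  one_mul a := (h.mul_comm S.one a).trans (h.mul_one a)
  mul_one := h.mul_one
  mul_comm := h.mul_comm
  npow := @npowRec _ ⟨S.one⟩ ⟨S.mul⟩

open Classical in
/-- The linear order underlying a model of `PA⁻`. -/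
noncomputable abbrev PAminus.linearOrder (h : PAminus S) : LinearOrder S.M where
  le a b := a = b ∨ S.lt a b
  lt := S.lt
  le_refl a := Or.inl rfl
  le_trans a b c := by
    rintro (rfl | h₁) (rfl | h₂)
    · exact Or.inl rfl
    · exact Or.inr h₂
    · exact Or.inr h₁
    · exact Or.inr (h.lt_trans _ _ _ h₁ h₂)
  lt_iff_le_not_ge a b := by
    constructor
    · refine fun h₁ => ⟨Or.inr h₁, ?_⟩
      rintro (rfl | h₂)
      · exact h.lt_irrefl _ h₁
      · exact h.lt_irrefl _ (h.lt_trans _ _ _ h₁ h₂)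
    · rintro ⟨rfl | h₁, h₂⟩
      · exact absurd (Or.inl rfl) h₂
      · exact h₁
  le_antisymm a b := by
    rintro (rfl | h₁) (h₂ | h₂)
    · rfl
    · rfl
    · exact h₂.symm
    · exact absurd (h.lt_trans _ _ _ h₁ h₂) (h.lt_irrefl _)
  le_total a b := by
    rcases h.lt_total a b with h₁ | h₁ | h₁
    · exact Or.inl (Or.inr h₁)
    · exact Or.inl (Or.inl h₁)
    · exact Or.inr (Or.inr h₁)
  toDecidableLE := Classical.decRel _

theorem PAminus.zero_le' (h : PAminus S) :
    letI := h.linearOrder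
    ∀ a : S.M, S.zero ≤ a :=
  fun a => (h.zero_le a).imp Eq.symm id

theorem PAminus.isOrderedRing (h : PAminus S) :
    letI := h.commSemiring
    letI := h.linearOrder
    IsOrderedRing S.M := by
  let _ := h.commSemiring
  let _ := h.linearOrder
  have hmul : ∀ a b c : S.M, a ≤ b → a * c ≤ b * c := by
    rintro a b c (rfl | hab)
    · exact le_rfl
    · rcases h.zero_le c with rfl | hc
      · exact ((h.mul_zero a).trans (h.mul_zero b).symm).le
      · exact Or.inr (h.mul_lt_mul _ _ _ hab hc)
  have hadd : ∀ a b : S.M, a ≤ b → ∀ c, a + c ≤ b + c := by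
    rintro a b (rfl | hab) c
    · exact le_rfl
    · exact Or.inr (h.add_lt_add _ _ _ hab)
  exact
    { add_le_add_left := hadd
      zero_le_one := h.zero_le' _
      mul_le_mul_of_nonneg_left := fun c _ a b hab => by
        rw [_root_.mul_comm c a, _root_.mul_comm c b]
        exact hmul a b c hab
      mul_le_mul_of_nonneg_right := fun c _ a b hab => hmul a b c hab }

theorem PAminus.add_left_cancel (h : PAminus S) {a b c : S.M}
    (e : S.add a b = S.add a c) : b = c := by
  rw [h.add_comm a b, h.add_comm a c] at e
  rcases h.lt_total b c with hl | hl | hl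
  · exact absurd (e ▸ h.add_lt_add _ _ a hl) (h.lt_irrefl _)
  · exact hl
  · exact absurd (e ▸ h.add_lt_add _ _ a hl) (h.lt_irrefl _)

theorem PAminus.lt_succ_iff (h : PAminus S) {a b : S.M} :
    S.lt a (S.add b S.one) ↔ a = b ∨ S.lt a b := by
  have hb : S.lt b (S.add b S.one) := by
    have := h.add_lt_add _ _ b h.zero_lt_one
    rwa [h.add_comm, h.add_zero, h.add_comm] at this
  constructor
  · intro hab
    rcases h.lt_total a b with hl | hl | hl
    · exact Or.inr hl
    · exact Or.inl hl
    · rcases h.discrete _ _ hl with rfl | h'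
      · exact absurd hab (h.lt_irrefl _)
      · exact absurd (h.lt_trans _ _ _ hab h') (h.lt_irrefl _)
  · rintro (rfl | hl)
    · exact hb
    · exact h.lt_trans _ _ _ hl hb

theorem PAminus.not_lt_zero (h : PAminus S) (a : S.M) : ¬ S.lt a S.zero := by
  let _ := h.linearOrder
  exact not_lt.2 (h.zero_le' a)

theorem PAminus.left_lt_add_succ (h : PAminus S) (a b : S.M) :
    S.lt a (S.add (S.add a b) S.one) := by
  let _ := h.commSemiring
  let _ := h.linearOrder
  have := h.isOrderedRing
  exact h.lt_succ_iff.2 (le_add_of_nonneg_right (h.zero_le' b))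

theorem PAminus.right_lt_add_succ (h : PAminus S) (a b : S.M) :
    S.lt b (S.add (S.add a b) S.one) := by
  rw [h.add_comm a b]
  exact h.left_lt_add_succ b a

theorem PAminus.left_lt_pair_succ (h : PAminus S) (a b : S.M) :
    S.lt a (S.add (pairS S a b) S.one) :=
  h.right_lt_add_succ _ _

theorem PAminus.right_lt_pair_succ (h : PAminus S) (a b : S.M) :
    S.lt b (S.add (pairS S a b) S.one) := by
  let _ := h.commSemiring
  let _ := h.linearOrder
  have := h.isOrderedRing
  refine h.lt_succ_iff.2 ?_
  have h0 : ∀ c : S.M, 0 ≤ c := h.zero_le'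
  have hsq : ∀ s : S.M, s ≤ s * s := by
    intro s
    rcases h.zero_le s with rfl | hs
    · exact h0 _
    · have h1 : (1 : S.M) ≤ s := by
        have := h.discrete _ _ hs
        rwa [h.add_comm, h.add_zero] at this
      exact le_mul_of_one_le_left (h0 s) h1
  change b ≤ (a + b) * (a + b) + a
  exact (le_add_of_nonneg_left (h0 a)).trans
    ((hsq _).trans (le_add_of_nonneg_right (h0 a)))

theorem PAminus.pair_lt_pair (h : PAminus S) {a b c d : S.M}
    (hs : S.lt (S.add a b) (S.add c d)) : S.lt (pairS S a b) (pairS S c d) := by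
  let _ := h.commSemiring
  let _ := h.linearOrder
  have := h.isOrderedRing
  have h0 : ∀ c : S.M, 0 ≤ c := h.zero_le'
  change (a + b) * (a + b) + a < (c + d) * (c + d) + c
  have h1 : a + b + 1 ≤ c + d := h.discrete _ _ hs
  have h2 : (a + b + 1) * (a + b + 1) ≤ (c + d) * (c + d) :=
    mul_le_mul h1 h1 (h0 _) (h0 _)
  have h3 : (a + b) * (a + b) + a < (a + b + 1) * (a + b + 1) := by
    have e : (a + b + 1) * (a + b + 1) =
        (a + b) * (a + b) + a + (a + b + b) + 1 := by ring
    rw [e]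
    exact h.left_lt_add_succ _ _
  exact h3.trans_le (h2.trans (le_add_of_nonneg_right (h0 c)))

theorem PAminus.pair_inj (h : PAminus S) {a b c d : S.M} :
    pairS S a b = pairS S c d ↔ a = c ∧ b = d := by
  constructor
  · intro e
    have hs : S.add a b = S.add c d := by
      rcases h.lt_total (S.add a b) (S.add c d) with hl | hl | hl
      · exact absurd (e ▸ h.pair_lt_pair hl) (h.lt_irrefl _)
      · exact hl
      · exact absurd (e ▸ h.pair_lt_pair hl) (h.lt_irrefl _)
    have hac : a = c := by
      unfold pairS at e
      rw [hs] at e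
      exact h.add_left_cancel e
    subst hac
    exact ⟨rfl, h.add_left_cancel hs⟩
  · rintro ⟨rfl, rfl⟩
    rfl

theorem PAminus.pair_mem_graphOf (h : PAminus S) {f : S.M → S.M} {a b : S.M} :
    pairS S a b ∈ graphOf S f ↔ f a = b := by
  constructor
  · rintro ⟨x, hx⟩
    obtain ⟨rfl, rfl⟩ := h.pair_inj.1 hx
    rfl
  · rintro rfl
    exact ⟨a, rfl⟩

end Pairing

/-! ## Sets and functions of a model of `RCA₀` -/

/-- The term `⟨t, u⟩`. -/
def Term.pair (t u : Term) : Term := .add (.mul (.add t u) (.add t u)) t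

@[simp] theorem tval_pair (S : Str) (v : ℕ → S.M) (t u : Term) :
    tval S v (t.pair u) = pairS S (tval S v t) (tval S v u) := rfl

/-- The term `t + 1`. -/
def Term.succ (t : Term) : Term := .add t .one

@[simp] theorem tval_succ (S : Str) (v : ℕ → S.M) (t : Term) :
    tval S v t.succ = S.add (tval S v t) S.one := rfl

@[simp] theorem upd_same {α : Type} (v : ℕ → α) (x : ℕ) (a : α) : upd v x a x = a := by
  simp [upd]

theorem upd_comm {α : Type} (v : ℕ → α) {x y : ℕ} (hxy : x ≠ y) (a b : α) :
    upd (upd v x a) y b = upd (upd v y b) x a := by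
  funext i
  simp only [upd]
  split_ifs <;> simp_all

section Reverse

variable {S : Str} {X : Set (Set S.M)}

theorem RCA0.delta0_comprehension (h : RCA0 S X) {θ : Fml} (hθ : Delta0SO θ) (v : ℕ → S.M)
    {w : ℕ → Set S.M} (hw : ∀ i, w i ∈ X) (x : ℕ) :
    {m | Sat S X (upd v x m) w θ} ∈ X := by
  obtain ⟨A, hA, hA'⟩ :=
    h.2.2 θ θ (.delta0 hθ) (.delta0 hθ) v w hw x (fun _ => Iff.rfl)
  rwa [show {m | Sat S X (upd v x m) w θ} = A from Set.ext fun m => (hA' m).symm]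

/-- The valuation of the set variables sending `X₀` to `A` and all others to `B`. -/
def setPair (A B : Set S.M) : ℕ → Set S.M := fun i => if i = 0 then A else B

theorem setPair_mem {A B : Set S.M} (hA : A ∈ X) (hB : B ∈ X) (i : ℕ) :
    setPair A B i ∈ X := by
  unfold setPair
  split_ifs <;> assumption

@[simp] theorem setPair_zero (A B : Set S.M) : setPair A B 0 = A := rfl

@[simp] theorem setPair_one (A B : Set S.M) : setPair A B 1 = B := rfl

theorem RCA0.compl_mem (h : RCA0 S X) {A : Set S.M} (hA : A ∈ X) : Aᶜ ∈ X := by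
  have := h.delta0_comprehension (.not (.mem (.var 0) 0)) (fun _ => S.zero)
    (setPair_mem hA hA) 0
  simpa [Sat, tval, upd, Set.compl_def] using this

theorem RCA0.inter_mem (h : RCA0 S X) {A B : Set S.M} (hA : A ∈ X) (hB : B ∈ X) :
    A ∩ B ∈ X := by
  have := h.delta0_comprehension (.and (.mem (.var 0) 0) (.mem (.var 0) 1)) (fun _ => S.zero)
    (setPair_mem hA hB) 0
  simpa [Sat, tval, upd] using this

theorem RCA0.empty_mem (h : RCA0 S X) {A : Set S.M} (hA : A ∈ X) : ∅ ∈ X := by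
  simpa using h.inter_mem hA (h.compl_mem hA)

theorem RCA0.const_mem (h : RCA0 S X) {A : Set S.M} (hA : A ∈ X) (p : Prop) :
    {_m : S.M | p} ∈ X := by
  by_cases hp : p
  · simpa [hp] using h.compl_mem (h.empty_mem hA)
  · simpa [hp] using h.empty_mem hA

/-- A function with a `Σ₁⁰` graph belongs to `X`.  The variables `1, 2, 3` of `θ` stand for the
argument, the value and the witness of the existential quantifier. -/
theorem RCA0.funcIn_of_graph (h : RCA0 S X) {θ : Fml} (hθ : Delta0SO θ)
    {w : ℕ → Set S.M} (hw : ∀ i, w i ∈ X) (f : S.M → S.M)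
    (hf : ∀ v : ℕ → S.M, f (v 1) = v 2 ↔ ∃ z, Sat S X (upd v 3 z) w θ) : FuncIn S X f := by
  obtain ⟨A, hA, hA'⟩ := h.2.2
    (.ex 1 (.ex 2 (.ex 3 (.and (.eq (.var 0) (.pair (.var 1) (.var 2))) θ))))
    (.all 4 (.all 1 (.all 2 (.all 3 (.and
      (.bex 5 (.succ (.var 0)) (.bex 6 (.succ (.var 0))
        (.eq (.var 0) (.pair (.var 5) (.var 6)))))
      (.imp (.eq (.var 0) (.pair (.var 1) (.var 4))) (.imp θ (.eq (.var 4) (.var 2)))))))))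
    (.ex _ (.ex _ (.ex _ (.delta0 (.and (.eq _ _) hθ)))))
    (.all _ (.all _ (.all _ (.all _ (.delta0 (.and (.bex _ _ (.bex _ _ (.eq _ _)))
      (.imp (.eq _ _) (.imp hθ (.eq _ _)))))))))
    (fun _ => S.zero) w hw 0 (by
      intro m
      constructor
      · rintro ⟨x, y, z, e, hz⟩ y₁ x₁ y₂ z₂
        simp [Sat, tval, upd] at e
        subst e
        refine ⟨⟨x, ?_, y, ?_, ?_⟩, ?_⟩
        · simpa [tval, upd] using h.1.left_lt_pair_succ x y
        · simpa [tval, upd] using h.1.right_lt_pair_succ x y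
        · simp [Sat, tval, upd]
        · intro e' h'
          simp [Sat, tval, upd] at e'
          have h1 := (hf _).2 ⟨z₂, h'⟩
          have h2 := (hf _).2 ⟨z, hz⟩
          obtain ⟨rfl, rfl⟩ := h.1.pair_inj.1 e'
          simp [Sat, tval, upd] at h1 h2 ⊢
          exact h2.symm.trans h1
      · intro H
        obtain ⟨⟨x, -, y, -, e⟩, -⟩ := H S.zero S.zero S.zero S.zero
        simp [Sat, tval, upd] at e
        obtain ⟨z, hz⟩ := (hf (upd (upd (upd (fun _ => S.zero) 0 m) 1 x) 2 (f x))).1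
          (by simp [upd])
        refine ⟨x, f x, z, ?_, hz⟩
        have h1 := fun z' => (H y x (f x) z').2
        obtain ⟨z', hz'⟩ := (hf (upd (upd (upd (upd (fun _ => S.zero) 0 m) 4 y) 1 x) 2 (f x))).1
          (by simp [upd])
        have h2 := h1 z' (by simp [Sat, tval, upd, e]) hz'
        simp [Sat, tval, upd] at h2
        simp [Sat, tval, upd, e, h2])
  have : graphOf S f = A := by
    ext m
    rw [hA']
    constructor
    · rintro ⟨x, rfl⟩
      obtain ⟨z, hz⟩ := (hf (upd (upd (upd (fun _ => S.zero) 0 (pairS S x (f x))) 1 x) 2 (f x))).1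
          (by simp [upd])
      exact ⟨x, f x, z, by simp [Sat, tval, upd], hz⟩
    · rintro ⟨x, y, z, e, hz⟩
      have := (hf _).2 ⟨z, hz⟩
      simp [Sat, tval, upd] at e this
      exact ⟨x, this ▸ e⟩
  unfold FuncIn
  rwa [this]

theorem RCA0.comp_mem (h : RCA0 S X) {f g : S.M → S.M} (hf : FuncIn S X f)
    (hg : FuncIn S X g) : FuncIn S X (fun i => f (g i)) :=
  h.funcIn_of_graph
    (.and (.mem (.pair (.var 1) (.var 3)) 0) (.mem (.pair (.var 3) (.var 2)) 1))
    (setPair_mem hg hf) _ fun v => by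
      simp [Sat, tval, upd, h.1.pair_mem_graphOf]

theorem RCA0.term_mem (h : RCA0 S X) {f g : S.M → S.M} (hf : FuncIn S X f)
    (hg : FuncIn S X g) (t : Term) (op : S.M → S.M → S.M)
    (ht : ∀ v, tval S v t = op (v 4) (v 5)) : FuncIn S X (fun i => op (f i) (g i)) :=
  h.funcIn_of_graph
    (.bex 4 (.succ (.var 3)) (.bex 5 (.succ (.var 3)) (.and
      (.mem (.pair (.var 1) (.var 4)) 0) (.and (.mem (.pair (.var 1) (.var 5)) 1)
        (.eq t (.var 2))))))
    (setPair_mem hf hg) _ fun v => by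
      simp only [Sat, tval_pair, tval_succ, ht]
      simp [tval, upd, h.1.pair_mem_graphOf]
      exact ⟨fun e => ⟨S.add (f (v 1)) (g (v 1)), h.1.left_lt_add_succ _ _,
        h.1.right_lt_add_succ _ _, e⟩, fun ⟨_, _, _, e⟩ => e⟩

theorem RCA0.preimage_mem (h : RCA0 S X) {f : S.M → S.M} (hf : FuncIn S X f)
    {A : Set S.M} (hA : A ∈ X) : {i | f i ∈ A} ∈ X := by
  obtain ⟨B, hB, hB'⟩ := h.2.2
    (.ex 1 (.and (.mem (.pair (.var 0) (.var 1)) 0) (.mem (.var 1) 1)))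
    (.all 1 (.imp (.mem (.pair (.var 0) (.var 1)) 0) (.mem (.var 1) 1)))
    (.ex _ (.delta0 (.and (.mem _ _) (.mem _ _))))
    (.all _ (.delta0 (.imp (.mem _ _) (.mem _ _))))
    (fun _ => S.zero) _ (setPair_mem hf hA) 0 (by
      simp [Sat, tval, upd, h.1.pair_mem_graphOf])
  convert hB using 1
  ext m
  simp [hB', Sat, tval, upd, h.1.pair_mem_graphOf]

theorem RCA0.exists_least (h : RCA0 S X) {A : Set S.M} (hA : A ∈ X) (hne : A.Nonempty) :
    ∃ a ∈ A, ∀ b, S.lt b a → b ∉ A := by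
  by_contra! H
  have key := h.2.1 (.ball 1 (.var 0) (.not (.mem (.var 1) 0)))
    (.delta0 (.ball _ _ (.not (.mem _ _)))) (fun _ => S.zero) _ (setPair_mem hA hA) 0
    (by simp [Sat, tval, upd, h.1.not_lt_zero])
    (by
      simp only [Sat, tval, upd]
      simp [h.1.lt_succ_iff]
      intro m hm
      refine ⟨fun hmA => ?_, hm⟩
      obtain ⟨c, hc, hcA⟩ := H m hmA
      exact hm c hc hcA)
  simp [Sat, tval, upd] at key
  obtain ⟨a, ha⟩ := hne
  obtain ⟨b, hb, hbA⟩ := H a ha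
  exact key a b hb hbA

theorem RCA0.section_mem (h : RCA0 S X) {A : Set S.M} (hA : A ∈ X) (i : S.M) :
    {y | pairS S i y ∈ A} ∈ X := by
  have := h.delta0_comprehension (.mem (.pair (.var 1) (.var 0)) 0) (fun _ => i)
    (setPair_mem hA hA) 0
  simpa [Sat, tval, upd] using this

/-- Uniformization: least witnesses for a set `B` of coded pairs form a function in `X`. -/
theorem RCA0.uniformization (h : RCA0 S X) {A B : Set S.M} (hA : A ∈ X) (hB : B ∈ X)
    (hAB : ∀ i ∈ A, ∃ y, pairS S i y ∈ B) :
    ∃ g, FuncIn S X g ∧ ∀ i ∈ A, pairS S i (g i) ∈ B := by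
  have hleast : ∀ i, ∃ y, (i ∈ A → pairS S i y ∈ B) ∧
      ∀ z, S.lt z y → (i ∈ A ∧ pairS S i z ∉ B) := by
    intro i
    by_cases hi : i ∈ A
    · obtain ⟨y, hy, hy'⟩ := h.exists_least (h.section_mem hB i) (hAB i hi)
      exact ⟨y, fun _ => hy, fun z hz => ⟨hi, hy' z hz⟩⟩
    · exact ⟨S.zero, fun hi' => absurd hi' hi, fun z hz => absurd hz (h.1.not_lt_zero z)⟩
  choose g hg hg' using hleast
  refine ⟨g, ?_, hg⟩
  refine h.funcIn_of_graph
    (.and (.imp (.mem (.var 1) 0) (.mem (.pair (.var 1) (.var 2)) 1))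
      (.ball 4 (.var 2) (.and (.mem (.var 1) 0) (.not (.mem (.pair (.var 1) (.var 4)) 1)))))
    (setPair_mem hA hB) _ fun v => ?_
  simp only [Sat, tval_pair]
  simp only [tval, upd, setPair_zero, setPair_one, Nat.reduceEqDiff, if_false, if_true]
  constructor
  · rintro e
    rw [← e]
    exact ⟨S.zero, hg _, hg' _⟩
  · rintro ⟨-, h1, h2⟩
    rcases h.1.lt_total (g (v 1)) (v 2) with hl | hl | hl
    · have := h2 _ hl
      exact absurd (hg _ this.1) this.2
    · exact hl
    · have := hg' _ _ hl
      exact absurd (h1 this.1) this.2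

/-- The two projections of the pairing function can be found in `X`. -/
theorem RCA0.exists_proj (h : RCA0 S X) (hX : Set.univ ∈ X) :
    ∃ p q : S.M → S.M, FuncIn S X p ∧ FuncIn S X q ∧
      ∀ x y, p (pairS S x y) = x ∧ q (pairS S x y) = y := by
  have hA := h.delta0_comprehension
    (.bex 1 (.succ (.var 0)) (.bex 2 (.succ (.var 0)) (.eq (.var 0) (.pair (.var 1) (.var 2)))))
    (fun _ => S.zero) (setPair_mem hX hX) 0
  have hB := h.delta0_comprehension
    (.bex 1 (.succ (.var 0)) (.bex 2 (.succ (.var 0)) (.bex 3 (.succ (.var 1))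
      (.and (.eq (.var 0) (.pair (.var 1) (.var 2))) (.eq (.var 1) (.pair (.var 2) (.var 3)))))))
    (fun _ => S.zero) (setPair_mem hX hX) 0
  have hC := h.delta0_comprehension
    (.bex 1 (.succ (.var 0)) (.bex 2 (.succ (.var 0)) (.bex 3 (.succ (.var 1))
      (.and (.eq (.var 0) (.pair (.var 1) (.var 2))) (.eq (.var 1) (.pair (.var 3) (.var 2)))))))
    (fun _ => S.zero) (setPair_mem hX hX) 0
  have hl := h.1.left_lt_pair_succ
  have hr := h.1.right_lt_pair_succ
  obtain ⟨p, hp, hp'⟩ := h.uniformization hA hB (by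
    rintro _ ⟨x, -, y, -, e⟩
    simp [Sat, tval, upd] at e
    subst e
    exact ⟨x, pairS S x y, by simpa [tval, upd] using hl _ _, x,
      by simpa [tval, upd] using hr _ _, y, by simpa [tval, upd] using hr _ _,
      by simp [Sat, tval, upd]⟩)
  obtain ⟨q, hq, hq'⟩ := h.uniformization hA hC (by
    rintro _ ⟨x, -, y, -, e⟩
    simp [Sat, tval, upd] at e
    subst e
    exact ⟨y, pairS S x y, by simpa [tval, upd] using hl _ _, y,
      by simpa [tval, upd] using hr _ _, x, by simpa [tval, upd] using hl _ _,
      by simp [Sat, tval, upd]⟩)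
  refine ⟨p, q, hp, hq, fun x y => ?_⟩
  have hxy : pairS S x y ∈ {m | Sat S X (upd (fun _ => S.zero) 0 m) (setPair Set.univ Set.univ)
      (.bex 1 (.succ (.var 0)) (.bex 2 (.succ (.var 0))
        (.eq (.var 0) (.pair (.var 1) (.var 2)))))} :=
    ⟨x, by simpa [tval, upd] using hl _ _, y, by simpa [tval, upd] using hr _ _,
      by simp [Sat, tval, upd]⟩
  constructor
  · obtain ⟨a, -, b, -, c, -, e⟩ := hp' _ hxy
    simp [Sat, tval, upd, h.1.pair_inj] at e
    obtain ⟨⟨rfl, rfl⟩, e⟩ := e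
    exact (h.1.pair_inj.1 e).1.symm
  · obtain ⟨a, -, b, -, c, -, e⟩ := hq' _ hxy
    simp [Sat, tval, upd, h.1.pair_inj] at e
    obtain ⟨⟨rfl, rfl⟩, e⟩ := e
    exact (h.1.pair_inj.1 e).2.symm

/-- Choice for relations that are decided by `X` along functions of `X`. -/
theorem RCA0.exists_choice (h : RCA0 S X) (hX : Set.univ ∈ X) {P : S.M → S.M → Prop}
    (hP : ∀ a b, FuncIn S X a → FuncIn S X b → {i | P (a i) (b i)} ∈ X)
    {A : Set S.M} (hA : A ∈ X) (hAP : ∀ i ∈ A, ∃ y, P i y) :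
    ∃ g, FuncIn S X g ∧ ∀ i ∈ A, P i (g i) := by
  obtain ⟨p, q, hp, hq, hpq⟩ := h.exists_proj hX
  obtain ⟨g, hg, hg'⟩ := h.uniformization hA (hP p q hp hq) (by simpa [hpq] using hAP)
  exact ⟨g, hg, by simpa [hpq] using hg'⟩

end Reverse

/-! ## Syntactic transformations -/

section Syntactic

theorem exists_term_rename (t : Term) (τ : ℕ → ℕ) :
    ∃ t' : Term, ∀ (S : Str) (v : ℕ → S.M), tval S v t' = tval S (fun i => v (τ i)) t := by
  induction t with
  | var i => exact ⟨.var (τ i), fun _ _ => rfl⟩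
  | zero => exact ⟨.zero, fun _ _ => rfl⟩
  | one => exact ⟨.one, fun _ _ => rfl⟩
  | add t u iht ihu =>
    obtain ⟨t', ht⟩ := iht
    obtain ⟨u', hu⟩ := ihu
    exact ⟨.add t' u', fun S v => by simp [tval, ht, hu]⟩
  | mul t u iht ihu =>
    obtain ⟨t', ht⟩ := iht
    obtain ⟨u', hu⟩ := ihu
    exact ⟨.mul t' u', fun S v => by simp [tval, ht, hu]⟩

/-- A renaming of variables whose values are either one of the three reserved
variables `0, 1, 2` or the shift by three. -/
def IsShift (τ : ℕ → ℕ) : Prop := ∀ i, τ i < 3 ∨ τ i = i + 3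

theorem IsShift.upd {τ : ℕ → ℕ} (h : IsShift τ) (x : ℕ) : IsShift (upd τ x (x + 3)) := by
  intro i
  unfold PaperArith.upd
  split_ifs with hi
  · exact Or.inr (hi ▸ rfl)
  · exact h i

theorem IsShift.upd_comp {τ : ℕ → ℕ} (h : IsShift τ) {α : Type} (v : ℕ → α) (x : ℕ) (m : α) :
    (fun i => PaperArith.upd v (x + 3) m (PaperArith.upd τ x (x + 3) i)) =
      PaperArith.upd (fun i => v (τ i)) x m := by
  funext i
  unfold PaperArith.upd
  by_cases hi : i = x
  · simp [hi]
  · have : τ i ≠ x + 3 := by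
      have := h i
      omega
    simp [hi, this]

theorem Delta0.exists_rename {φ : Fml} (hφ : Delta0 φ) {τ : ℕ → ℕ} (hτ : IsShift τ) :
    ∃ φ', Delta0 φ' ∧ ∀ (S : Str) (v : ℕ → S.M),
      Sat0 S v φ' ↔ Sat0 S (fun i => v (τ i)) φ := by
  induction hφ generalizing τ with
  | eq t u =>
    obtain ⟨t', ht⟩ := exists_term_rename t τ
    obtain ⟨u', hu⟩ := exists_term_rename u τ
    exact ⟨.eq t' u', .eq _ _, fun S v => by simp [Sat0, Sat, ht, hu]⟩
  | lt t u =>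
    obtain ⟨t', ht⟩ := exists_term_rename t τ
    obtain ⟨u', hu⟩ := exists_term_rename u τ
    exact ⟨.lt t' u', .lt _ _, fun S v => by simp [Sat0, Sat, ht, hu]⟩
  | not _ ih =>
    obtain ⟨φ', h, h'⟩ := ih hτ
    exact ⟨.not φ', .not h, fun S v => not_congr (h' S v)⟩
  | and _ _ ih₁ ih₂ =>
    obtain ⟨φ', h, h'⟩ := ih₁ hτ
    obtain ⟨ψ', k, k'⟩ := ih₂ hτ
    exact ⟨.and φ' ψ', .and h k, fun S v => and_congr (h' S v) (k' S v)⟩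
  | or _ _ ih₁ ih₂ =>
    obtain ⟨φ', h, h'⟩ := ih₁ hτ
    obtain ⟨ψ', k, k'⟩ := ih₂ hτ
    exact ⟨.or φ' ψ', .or h k, fun S v => or_congr (h' S v) (k' S v)⟩
  | imp _ _ ih₁ ih₂ =>
    obtain ⟨φ', h, h'⟩ := ih₁ hτ
    obtain ⟨ψ', k, k'⟩ := ih₂ hτ
    exact ⟨.imp φ' ψ', .imp h k, fun S v => imp_congr (h' S v) (k' S v)⟩
  | ball x t _ ih =>
    obtain ⟨t', ht⟩ := exists_term_rename t τ
    obtain ⟨φ', h, h'⟩ := ih (hτ.upd x)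
    refine ⟨.ball (x + 3) t' φ', .ball _ _ h, fun S v => forall_congr' fun m => ?_⟩
    rw [ht]
    exact imp_congr_right fun _ => (h' S _).trans (by rw [hτ.upd_comp, Sat0])
  | bex x t _ ih =>
    obtain ⟨t', ht⟩ := exists_term_rename t τ
    obtain ⟨φ', h, h'⟩ := ih (hτ.upd x)
    refine ⟨.bex (x + 3) t' φ', .bex _ _ h, fun S v => exists_congr fun m => ?_⟩
    rw [ht]
    exact and_congr_right fun _ => (h' S _).trans (by rw [hτ.upd_comp, Sat0])

/-- The valuation obtained from `v` by putting `x, y` in the places `1, 2`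
and renaming along `τ`. -/
def mergeVal {α : Type} (τ : ℕ → ℕ) (v : ℕ → α) (x y : α) : ℕ → α :=
  fun i => upd (upd v 1 x) 2 y (τ i)

theorem IsShift.mergeVal_upd {τ : ℕ → ℕ} (h : IsShift τ) {α : Type} (v : ℕ → α) (x y : α)
    (z : ℕ) (m : α) :
    mergeVal (PaperArith.upd τ z (z + 3)) (PaperArith.upd v (z + 3) m) x y =
      PaperArith.upd (mergeVal τ v x y) z m := by
  unfold mergeVal
  rw [upd_comm v (by omega), upd_comm _ (by omega : z + 3 ≠ 2), h.upd_comp]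

/-- `φ'` expresses `φ` with the components of the pair coded by the variable `0` substituted for
some of its variables. -/
def Merges (S : Str) (τ : ℕ → ℕ) (φ φ' : Fml) : Prop :=
  ∀ (v : ℕ → S.M) (x y : S.M), v 0 = pairS S x y →
    (Sat0 S v φ' ↔ Sat0 S (mergeVal τ v x y) φ)

theorem Delta0.exists_merge {S : Str} (hS : PAminus S) {φ : Fml} (hφ : Delta0 φ) {τ : ℕ → ℕ}
    (hτ : IsShift τ) : ∃ φ', Delta0 φ' ∧ Merges S τ φ φ' := by
  obtain ⟨θ, hθ, hθ'⟩ := hφ.exists_rename hτ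
  refine ⟨.bex 1 (.succ (.var 0)) (.bex 2 (.succ (.var 0))
    (.and (.eq (.var 0) (.pair (.var 1) (.var 2))) θ)),
    .bex _ _ (.bex _ _ (.and (.eq _ _) hθ)), fun v x y e => ?_⟩
  constructor
  · rintro ⟨a, -, b, -, e', hab⟩
    simp [Sat, tval, upd, e, hS.pair_inj] at e'
    obtain ⟨rfl, rfl⟩ := e'
    exact (hθ' S _).1 hab
  · intro H
    refine ⟨x, ?_, y, ?_, ?_, (hθ' S _).2 H⟩
    · simpa [tval, e] using hS.left_lt_pair_succ x y
    · simpa [tval, upd, e] using hS.right_lt_pair_succ x y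
    · simp [Sat, tval, upd, e]

mutual

theorem IsSigma.exists_merge {S : Str} (hS : PAminus S) {n : ℕ} {φ : Fml} (hφ : IsSigma n φ)
    {τ : ℕ → ℕ} (hτ : IsShift τ) : ∃ φ', IsSigma n φ' ∧ Merges S τ φ φ' := by
  cases hφ with
  | delta0 h =>
    obtain ⟨φ', h, h'⟩ := h.exists_merge hS hτ
    exact ⟨φ', .delta0 h, h'⟩
  | ofPi h =>
    obtain ⟨φ', h, h'⟩ := h.exists_merge hS hτ
    exact ⟨φ', .ofPi h, h'⟩
  | ex z h =>
    obtain ⟨φ', h, h'⟩ := h.exists_merge hS (hτ.upd z)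
    refine ⟨.ex (z + 3) φ', .ex _ h, fun v x y e => exists_congr fun m => ?_⟩
    exact (h' _ x y (by simpa [upd] using e)).trans (by rw [hτ.mergeVal_upd, Sat0])

theorem IsPi.exists_merge {S : Str} (hS : PAminus S) {n : ℕ} {φ : Fml} (hφ : IsPi n φ)
    {τ : ℕ → ℕ} (hτ : IsShift τ) : ∃ φ', IsPi n φ' ∧ Merges S τ φ φ' := by
  cases hφ with
  | delta0 h =>
    obtain ⟨φ', h, h'⟩ := h.exists_merge hS hτ
    exact ⟨φ', .delta0 h, h'⟩
  | ofSigma h =>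
    obtain ⟨φ', h, h'⟩ := h.exists_merge hS hτ
    exact ⟨φ', .ofSigma h, h'⟩
  | all z h =>
    obtain ⟨φ', h, h'⟩ := h.exists_merge hS (hτ.upd z)
    refine ⟨.all (z + 3) φ', .all _ h, fun v x y e => forall_congr' fun m => ?_⟩
    exact (h' _ x y (by simpa [upd] using e)).trans (by rw [hτ.mergeVal_upd, Sat0])

end

mutual

theorem IsSigma.exists_neg {n : ℕ} {φ : Fml} (hφ : IsSigma n φ) :
    ∃ φ', IsPi n φ' ∧ ∀ (S : Str) (v : ℕ → S.M), Sat0 S v φ' ↔ ¬ Sat0 S v φ := by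
  cases hφ with
  | delta0 h => exact ⟨.not φ, .delta0 (.not h), fun _ _ => Iff.rfl⟩
  | ofPi h =>
    obtain ⟨φ', h, h'⟩ := h.exists_neg
    exact ⟨φ', .ofSigma h, h'⟩
  | ex z h =>
    obtain ⟨φ', h, h'⟩ := h.exists_neg
    exact ⟨.all z φ', .all z h, fun S v =>
      (forall_congr' fun m => h' S _).trans not_exists.symm⟩

theorem IsPi.exists_neg {n : ℕ} {φ : Fml} (hφ : IsPi n φ) :
    ∃ φ', IsSigma n φ' ∧ ∀ (S : Str) (v : ℕ → S.M), Sat0 S v φ' ↔ ¬ Sat0 S v φ := by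
  cases hφ with
  | delta0 h => exact ⟨.not φ, .delta0 (.not h), fun _ _ => Iff.rfl⟩
  | ofSigma h =>
    obtain ⟨φ', h, h'⟩ := h.exists_neg
    exact ⟨φ', .ofPi h, h'⟩
  | all z h =>
    obtain ⟨φ', h, h'⟩ := h.exists_neg
    exact ⟨.ex z φ', .ex z h, fun S v =>
      (exists_congr fun m => h' S _).trans not_forall.symm⟩

end

mutual

theorem IsSigma.succ {n : ℕ} {φ : Fml} (hφ : IsSigma n φ) : IsSigma (n + 1) φ := by
  cases hφ with
  | delta0 h => exact .delta0 h
  | ofPi h => exact .ofPi h.succ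
  | ex z h => exact .ex z h.succ

theorem IsPi.succ {n : ℕ} {φ : Fml} (hφ : IsPi n φ) : IsPi (n + 1) φ := by
  cases hφ with
  | delta0 h => exact .delta0 h
  | ofSigma h => exact .ofSigma h.succ
  | all z h => exact .all z h.succ

end

theorem IsSigma.mono {m n : ℕ} (hmn : m ≤ n) {φ : Fml} (hφ : IsSigma m φ) : IsSigma n φ := by
  induction hmn with
  | refl => exact hφ
  | step _ ih => exact ih.succ

theorem IsPi.mono {m n : ℕ} (hmn : m ≤ n) {φ : Fml} (hφ : IsPi m φ) : IsPi n φ := by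
  induction hmn with
  | refl => exact hφ
  | step _ ih => exact ih.succ

theorem exists_tval_congr (t : Term) :
    ∃ N, ∀ (S : Str) (v v' : ℕ → S.M), (∀ i < N, v i = v' i) → tval S v t = tval S v' t := by
  induction t with
  | var i => exact ⟨i + 1, fun S v v' h => h i (Nat.lt_succ_self i)⟩
  | zero => exact ⟨0, fun _ _ _ _ => rfl⟩
  | one => exact ⟨0, fun _ _ _ _ => rfl⟩
  | add t u iht ihu =>
    obtain ⟨a, ha⟩ := iht
    obtain ⟨b, hb⟩ := ihu
    exact ⟨max a b, fun S v v' h => congr_arg₂ S.add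
      (ha S v v' fun i hi => h i (lt_max_of_lt_left hi))
      (hb S v v' fun i hi => h i (lt_max_of_lt_right hi))⟩
  | mul t u iht ihu =>
    obtain ⟨a, ha⟩ := iht
    obtain ⟨b, hb⟩ := ihu
    exact ⟨max a b, fun S v v' h => congr_arg₂ S.mul
      (ha S v v' fun i hi => h i (lt_max_of_lt_left hi))
      (hb S v v' fun i hi => h i (lt_max_of_lt_right hi))⟩

theorem upd_congr {α : Type} {v v' : ℕ → α} {N : ℕ} (h : ∀ i < N, v i = v' i) (x : ℕ) (m : α) :
    ∀ i < N, upd v x m i = upd v' x m i := by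
  intro i hi
  simp only [upd, h i hi]

/-- Only finitely many variables matter for the truth of a formula. -/
theorem exists_sat_congr (φ : Fml) :
    ∃ N, ∀ (S : Str) (X : Set (Set S.M)) (v v' : ℕ → S.M) (w : ℕ → Set S.M),
      (∀ i < N, v i = v' i) → (Sat S X v w φ ↔ Sat S X v' w φ) := by
  induction φ with
  | eq t u =>
    obtain ⟨a, ha⟩ := exists_tval_congr t
    obtain ⟨b, hb⟩ := exists_tval_congr u
    refine ⟨max a b, fun S X v v' w h => ?_⟩
    rw [Sat, Sat, ha S v v' fun i hi => h i (lt_max_of_lt_left hi),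
      hb S v v' fun i hi => h i (lt_max_of_lt_right hi)]
  | lt t u =>
    obtain ⟨a, ha⟩ := exists_tval_congr t
    obtain ⟨b, hb⟩ := exists_tval_congr u
    refine ⟨max a b, fun S X v v' w h => ?_⟩
    rw [Sat, Sat, ha S v v' fun i hi => h i (lt_max_of_lt_left hi),
      hb S v v' fun i hi => h i (lt_max_of_lt_right hi)]
  | mem t i =>
    obtain ⟨a, ha⟩ := exists_tval_congr t
    refine ⟨a, fun S X v v' w h => ?_⟩
    rw [Sat, Sat, ha S v v' h]
  | not φ ih =>
    obtain ⟨a, ha⟩ := ih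
    exact ⟨a, fun S X v v' w h => not_congr (ha S X v v' w h)⟩
  | and φ ψ ih₁ ih₂ =>
    obtain ⟨a, ha⟩ := ih₁
    obtain ⟨b, hb⟩ := ih₂
    exact ⟨max a b, fun S X v v' w h => and_congr
      (ha S X v v' w fun i hi => h i (lt_max_of_lt_left hi))
      (hb S X v v' w fun i hi => h i (lt_max_of_lt_right hi))⟩
  | or φ ψ ih₁ ih₂ =>
    obtain ⟨a, ha⟩ := ih₁
    obtain ⟨b, hb⟩ := ih₂
    exact ⟨max a b, fun S X v v' w h => or_congr
      (ha S X v v' w fun i hi => h i (lt_max_of_lt_left hi))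
      (hb S X v v' w fun i hi => h i (lt_max_of_lt_right hi))⟩
  | imp φ ψ ih₁ ih₂ =>
    obtain ⟨a, ha⟩ := ih₁
    obtain ⟨b, hb⟩ := ih₂
    exact ⟨max a b, fun S X v v' w h => imp_congr
      (ha S X v v' w fun i hi => h i (lt_max_of_lt_left hi))
      (hb S X v v' w fun i hi => h i (lt_max_of_lt_right hi))⟩
  | all x φ ih =>
    obtain ⟨a, ha⟩ := ih
    exact ⟨a, fun S X v v' w h => forall_congr' fun m => ha S X _ _ w (upd_congr h x m)⟩
  | ex x φ ih =>
    obtain ⟨a, ha⟩ := ih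
    exact ⟨a, fun S X v v' w h => exists_congr fun m => ha S X _ _ w (upd_congr h x m)⟩
  | ball x t φ ih =>
    obtain ⟨a, ha⟩ := ih
    obtain ⟨b, hb⟩ := exists_tval_congr t
    refine ⟨max a b, fun S X v v' w h => forall_congr' fun m => ?_⟩
    rw [hb S v v' fun i hi => h i (lt_max_of_lt_right hi)]
    exact imp_congr_right fun _ =>
      ha S X _ _ w (upd_congr (fun i hi => h i (lt_max_of_lt_left hi)) x m)
  | bex x t φ ih =>
    obtain ⟨a, ha⟩ := ih
    obtain ⟨b, hb⟩ := exists_tval_congr t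
    refine ⟨max a b, fun S X v v' w h => exists_congr fun m => ?_⟩
    rw [hb S v v' fun i hi => h i (lt_max_of_lt_right hi)]
    exact and_congr_right fun _ =>
      ha S X _ _ w (upd_congr (fun i hi => h i (lt_max_of_lt_left hi)) x m)
  | sall i φ ih =>
    obtain ⟨a, ha⟩ := ih
    exact ⟨a, fun S X v v' w h => forall_congr' fun A => forall_congr' fun _ =>
      ha S X v v' _ h⟩
  | sex i φ ih =>
    obtain ⟨a, ha⟩ := ih
    exact ⟨a, fun S X v v' w h => exists_congr fun A => and_congr_right fun _ =>
      ha S X v v' _ h⟩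

end Syntactic

/-! ## Definable sets along functions of `X` -/

section Good

/-- `φ` is decided by `X` along functions of `X`. -/
def Good (S : Str) (X : Set (Set S.M)) (φ : Fml) : Prop :=
  ∀ F : ℕ → S.M → S.M, (∀ j, FuncIn S X (F j)) → {i | Sat0 S (fun j => F j i) φ} ∈ X

variable {S : Str} {X : Set (Set S.M)}

theorem RCA0.pair_mem (h : RCA0 S X) {f g : S.M → S.M} (hf : FuncIn S X f)
    (hg : FuncIn S X g) : FuncIn S X (fun i => pairS S (f i) (g i)) :=
  h.term_mem hf hg (.pair (.var 4) (.var 5)) (pairS S) fun _ => rfl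

theorem RCA0.add_mem (h : RCA0 S X) {f g : S.M → S.M} (hf : FuncIn S X f)
    (hg : FuncIn S X g) : FuncIn S X (fun i => S.add (f i) (g i)) :=
  h.term_mem hf hg (.add (.var 4) (.var 5)) S.add fun _ => rfl

theorem RCA0.mul_mem (h : RCA0 S X) {f g : S.M → S.M} (hf : FuncIn S X f)
    (hg : FuncIn S X g) : FuncIn S X (fun i => S.mul (f i) (g i)) :=
  h.term_mem hf hg (.mul (.var 4) (.var 5)) S.mul fun _ => rfl

theorem RCA0.const_func_mem (h : RCA0 S X) (hX : Set.univ ∈ X) (a : S.M) :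
    FuncIn S X (fun _ => a) := by
  have := h.delta0_comprehension (.bex 1 (.succ (.var 0)) (.eq (.var 0) (.pair (.var 1) (.var 2))))
    (fun _ => a) (setPair_mem hX hX) 0
  unfold FuncIn
  convert this using 1
  ext m
  constructor
  · rintro ⟨x, rfl⟩
    exact ⟨x, by simpa [tval, upd] using h.1.left_lt_pair_succ _ _, by simp [Sat, tval, upd]⟩
  · rintro ⟨x, -, e⟩
    simp [Sat, tval, upd] at e
    exact ⟨x, e⟩

theorem RCA0.good_aux (h : RCA0 S X) (hX : Set.univ ∈ X) {n : ℕ} (hCA : SigmaCA S X n) (k : ℕ) :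
    ∀ (l : List ℕ), l.length ≤ k → ∀ (φ : Fml), IsSigma n φ → ∀ F : ℕ → S.M → S.M,
      (∀ j, FuncIn S X (F j)) → (∀ j ∉ l, ∃ a, ∀ i, F j i = a) →
      {i | Sat0 S (fun j => F j i) φ} ∈ X := by
  induction k with
  | zero =>
    intro l hl φ _ F hF hc
    obtain rfl := List.length_eq_zero_iff.1 (Nat.le_zero.1 hl)
    choose c hc using fun j => hc j (by simp)
    simpa only [hc] using h.const_mem hX (Sat0 S c φ)
  | succ k ih =>
    intro l hl φ hφ F hF hc
    match l, hl, hc with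
    | [], _, hc => exact ih [] (by simp) φ hφ F hF hc
    | [a], _, hc =>
      have : Nonempty S.M := ⟨S.zero⟩
      choose! c hc using hc
      obtain ⟨A, hA, hA'⟩ := hCA φ hφ c a
      convert h.preimage_mem (hF a) hA using 1
      ext i
      simp only [Set.mem_ofPred_eq, hA']
      have : (fun j => F j i) = upd c a (F a i) := by
        funext j
        unfold upd
        split_ifs with hj
        · rw [hj]
        · exact hc j (by simpa using hj) i
      rw [this]
    | a :: b :: l, hl, hc =>
      let τ : ℕ → ℕ := fun j => if j = a then 1 else if j = b then 2 else j + 3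
      have hτ : IsShift τ := by
        intro i
        simp only [τ]
        split_ifs <;> simp
      obtain ⟨φ', hφ', hm⟩ := hφ.exists_merge h.1 hτ
      let G : ℕ → S.M → S.M := fun j =>
        if j = 0 then fun i => pairS S (F a i) (F b i)
        else if j < 3 ∨ j = a + 3 ∨ j = b + 3 then fun _ => S.zero else F (j - 3)
      have hG : ∀ j, FuncIn S X (G j) := by
        intro j
        simp only [G]
        split_ifs
        · exact h.pair_mem (hF a) (hF b)
        · exact h.const_func_mem hX _
        · exact hF _
      have hGc : ∀ j ∉ 0 :: l.map (· + 3), ∃ c, ∀ i, G j i = c := by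
        intro j hj
        simp only [List.mem_cons, List.mem_map, not_or, not_exists, not_and] at hj
        by_cases hj' : j < 3 ∨ j = a + 3 ∨ j = b + 3
        · exact ⟨S.zero, fun i => by simp [G, hj.1, hj']⟩
        · obtain ⟨c, hc⟩ := hc (j - 3) (by
            simp only [List.mem_cons, not_or]
            refine ⟨by omega, by omega, fun hl => hj.2 _ hl (by omega)⟩)
          exact ⟨c, fun i => by simp [G, hj.1, hj', hc]⟩
      convert ih (0 :: l.map (· + 3)) (by simpa using hl) φ' hφ' G hG hGc using 1
      ext i
      simp only [Set.mem_ofPred_eq]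
      rw [hm (fun j => G j i) (F a i) (F b i) (by simp [G])]
      have : (fun j => F j i) = mergeVal τ (fun j => G j i) (F a i) (F b i) := by
        funext j
        simp only [mergeVal, τ, upd]
        by_cases ha : j = a
        · simp [ha]
        · by_cases hb : j = b
          · subst hb
            simp [ha]
          · simp [ha, hb, G]
      rw [this]

theorem RCA0.good_of_isSigma (h : RCA0 S X) (hX : Set.univ ∈ X) {n : ℕ}
    (hCA : SigmaCA S X n) {φ : Fml} (hφ : IsSigma n φ) : Good S X φ := by
  intro F hF
  obtain ⟨N, hN⟩ := exists_sat_congr φ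
  have := h.good_aux hX hCA N (List.range N) (by simp) φ hφ
    (fun j => if j < N then F j else fun _ => S.zero)
    (by
      intro j
      split_ifs
      · exact hF j
      · exact h.const_func_mem hX _)
    (fun j hj => ⟨S.zero, fun i => by simp [List.mem_range.not.1 hj]⟩)
  convert this using 1
  ext i
  exact hN S _ _ _ _ fun j hj => by simp [hj]

theorem RCA0.good_of_isPi (h : RCA0 S X) (hX : Set.univ ∈ X) {n : ℕ}
    (hCA : SigmaCA S X n) {φ : Fml} (hφ : IsPi n φ) : Good S X φ := by
  intro F hF
  obtain ⟨ψ, hψ, hψ'⟩ := hφ.exists_neg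
  convert h.compl_mem (h.good_of_isSigma hX hCA hψ F hF) using 1
  ext i
  simp [hψ']

end Good

/-! ## Łoś's theorem for the restricted ultrapower -/

section Los

variable {S : Str} {X U : Set (Set S.M)}

theorem UltraOn.univ_mem' (hU : UltraOn S X U) : Set.univ ∈ X := hU.subset hU.univ_mem

theorem UltraOn.compl_mem_iff (hU : UltraOn S X U) {A : Set S.M} (hA : A ∈ X) :
    Aᶜ ∈ U ↔ A ∉ U := by
  refine ⟨fun h h' => hU.empty_not_mem ?_, fun h => (hU.ultra A hA).resolve_left h⟩
  simpa using hU.inter_mem _ h' _ h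

theorem UltraOn.inter_mem_iff (hU : UltraOn S X U) {A B : Set S.M} (hA : A ∈ X) (hB : B ∈ X) :
    A ∩ B ∈ U ↔ A ∈ U ∧ B ∈ U :=
  ⟨fun h => ⟨hU.superset_mem _ h _ hA Set.inter_subset_left,
    hU.superset_mem _ h _ hB Set.inter_subset_right⟩, fun h => hU.inter_mem _ h.1 _ h.2⟩

theorem funcIn_upd {F : ℕ → S.M → S.M} (hF : ∀ j, FuncIn S X (F j)) (x : ℕ) {g : S.M → S.M}
    (hg : FuncIn S X g) (j : ℕ) : FuncIn S X (upd F x g j) := by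
  unfold upd
  split_ifs
  · exact hg
  · exact hF j

theorem upd_apply_fun (F : ℕ → S.M → S.M) (x : ℕ) (g : S.M → S.M) (i : S.M) :
    (fun j => upd F x g j i) = upd (fun j => F j i) x (g i) := by
  funext j
  unfold upd
  split_ifs <;> rfl

/-- The valuation in the restricted ultrapower given by a sequence of functions. -/
def RUP.val (R : RUP S X U) {F : ℕ → S.M → S.M} (hF : ∀ j, FuncIn S X (F j)) : ℕ → R.K.M :=
  fun j => R.cls (F j) (hF j)

theorem RUP.upd_val (R : RUP S X U) {F : ℕ → S.M → S.M} (hF : ∀ j, FuncIn S X (F j)) (x : ℕ)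
    {g : S.M → S.M} (hg : FuncIn S X g) :
    upd (R.val hF) x (R.cls g hg) = R.val (funcIn_upd hF x hg) := by
  funext j
  unfold RUP.val
  by_cases hj : j = x
  · simp [upd, hj]
  · simp [upd, hj]

theorem RUP.exists_cls (R : RUP S X U) {p : R.K.M → Prop} :
    (∃ b, p b) ↔ ∃ g, ∃ hg : FuncIn S X g, p (R.cls g hg) := by
  constructor
  · rintro ⟨b, hb⟩
    obtain ⟨g, hg, rfl⟩ := R.surj b
    exact ⟨g, hg, hb⟩
  · rintro ⟨g, hg, h⟩
    exact ⟨_, h⟩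

theorem RUP.exists_tval (R : RUP S X U) (h : RCA0 S X) {F : ℕ → S.M → S.M}
    (hF : ∀ j, FuncIn S X (F j)) (t : Term) :
    ∃ ht : FuncIn S X (fun i => tval S (fun j => F j i) t),
      tval R.K (R.val hF) t = R.cls _ ht := by
  induction t with
  | var j => exact ⟨hF j, rfl⟩
  | zero => exact ⟨R.const_in _, R.zero_eq⟩
  | one => exact ⟨R.const_in _, R.one_eq⟩
  | add t u iht ihu =>
    obtain ⟨ht, ht'⟩ := iht
    obtain ⟨hu, hu'⟩ := ihu
    refine ⟨h.add_mem ht hu, ?_⟩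
    rw [tval, ht', hu']
    exact R.add_eq _ _ _ _ _ _ fun _ => rfl
  | mul t u iht ihu =>
    obtain ⟨ht, ht'⟩ := iht
    obtain ⟨hu, hu'⟩ := ihu
    refine ⟨h.mul_mem ht hu, ?_⟩
    rw [tval, ht', hu']
    exact R.mul_eq _ _ _ _ _ _ fun _ => rfl

/-- `φ` satisfies Łoś's theorem. -/
def RUP.Los (R : RUP S X U) (φ : Fml) : Prop :=
  ∀ F : ℕ → S.M → S.M, ∀ hF : ∀ j, FuncIn S X (F j),
    Sat0 R.K (R.val hF) φ ↔ {i | Sat0 S (fun j => F j i) φ} ∈ U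

theorem RUP.Los.of_equiv {R : RUP S X U} {φ ψ : Fml} (hψ : R.Los ψ)
    (e : ∀ (S : Str) (v : ℕ → S.M), Sat0 S v φ ↔ Sat0 S v ψ) : R.Los φ := by
  intro F hF
  simpa only [e] using hψ F hF

theorem Good.of_equiv {φ ψ : Fml} (hψ : Good S X ψ)
    (e : ∀ (S : Str) (v : ℕ → S.M), Sat0 S v φ ↔ Sat0 S v ψ) : Good S X φ := by
  intro F hF
  simpa only [e] using hψ F hF

theorem RUP.Los.not {R : RUP S X U} (hU : UltraOn S X U) {φ : Fml} (hφ : R.Los φ)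
    (gφ : Good S X φ) : R.Los (.not φ) :=
  fun F hF => (not_congr (hφ F hF)).trans (hU.compl_mem_iff (gφ F hF)).symm

theorem RUP.Los.and {R : RUP S X U} (hU : UltraOn S X U) {φ ψ : Fml} (hφ : R.Los φ)
    (gφ : Good S X φ) (hψ : R.Los ψ) (gψ : Good S X ψ) : R.Los (.and φ ψ) :=
  fun F hF => (and_congr (hφ F hF) (hψ F hF)).trans
    (hU.inter_mem_iff (gφ F hF) (gψ F hF)).symm

theorem Good.not (h : RCA0 S X) {φ : Fml} (gφ : Good S X φ) : Good S X (.not φ) :=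
  fun F hF => h.compl_mem (gφ F hF)

/-- The value of a good formula at a function and a new argument is decided along functions. -/
theorem Good.along (h : RCA0 S X) {φ : Fml} (gφ : Good S X φ) {F : ℕ → S.M → S.M}
    (hF : ∀ j, FuncIn S X (F j)) (x : ℕ) {a b : S.M → S.M} (ha : FuncIn S X a)
    (hb : FuncIn S X b) : {i | Sat0 S (upd (fun j => F j (a i)) x (b i)) φ} ∈ X := by
  have := gφ _ (funcIn_upd (fun j => h.comp_mem (hF j) ha) x hb)
  simpa only [upd_apply_fun] using this

theorem RCA0.id_mem (h : RCA0 S X) (hX : Set.univ ∈ X) : FuncIn S X fun i => i :=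
  h.funcIn_of_graph (.eq (.var 1) (.var 2)) (setPair_mem hX hX) _ fun v => by
    simpa [Sat, tval, upd] using fun _ => ⟨S.zero⟩

theorem UltraOn.exists_mem_iff (hU : UltraOn S X U) (h : RCA0 S X) {P : S.M → S.M → Prop}
    (hP : ∀ a b, FuncIn S X a → FuncIn S X b → {i | P (a i) (b i)} ∈ X)
    (hid : FuncIn S X fun i => i) (hE : {i | ∃ y, P i y} ∈ X) :
    {i | ∃ y, P i y} ∈ U ↔ ∃ g, FuncIn S X g ∧ {i | P i (g i)} ∈ U := by
  constructor
  · intro hEU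
    obtain ⟨g, hg, hg'⟩ := h.exists_choice hU.univ_mem' hP hE fun i hi => hi
    exact ⟨g, hg, hU.superset_mem _ hEU _ (hP _ _ hid hg) hg'⟩
  · rintro ⟨g, hg, hgU⟩
    exact hU.superset_mem _ hgU _ hE fun i hi => ⟨g i, hi⟩

theorem RUP.Los.ex {R : RUP S X U} (hU : UltraOn S X U) (h : RCA0 S X) {φ : Fml}
    (hφ : R.Los φ) (gφ : Good S X φ) (x : ℕ) (g : Good S X (.ex x φ)) : R.Los (.ex x φ) := by
  intro F hF
  have key := hU.exists_mem_iff h (P := fun i y => Sat0 S (upd (fun j => F j i) x y) φ)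
    (fun a b ha hb => gφ.along h hF x ha hb) (h.id_mem hU.univ_mem') (g F hF)
  refine Iff.trans ?_ key.symm
  refine R.exists_cls.trans ?_
  refine exists_congr fun f => (exists_congr fun hf => ?_).trans exists_prop
  have := hφ _ (funcIn_upd hF x hf)
  rw [← R.upd_val hF x hf] at this
  simp only [upd_apply_fun] at this
  exact this

theorem RUP.Los.all {R : RUP S X U} (hU : UltraOn S X U) (h : RCA0 S X) {φ : Fml}
    (hφ : R.Los φ) (gφ : Good S X φ) (x : ℕ) (g : Good S X (.all x φ)) : R.Los (.all x φ) := by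
  have e : ∀ (S : Str) (v : ℕ → S.M),
      Sat0 S v (.ex x (.not φ)) ↔ Sat0 S v (.not (.all x φ)) := by
    intro S v
    simp [Sat0, Sat]
  have g' := (g.not h).of_equiv e
  refine ((RUP.Los.ex hU h (hφ.not hU gφ) (gφ.not h) x g').not hU g').of_equiv ?_
  intro S v
  simp [Sat0, Sat]

theorem RUP.Los.bex {R : RUP S X U} (hU : UltraOn S X U) (h : RCA0 S X) {φ : Fml}
    (hφ : R.Los φ) (gφ : Good S X φ) (glt : Good S X (.lt (.var 0) (.var 1)))
    (x : ℕ) (t : Term) (g : Good S X (.bex x t φ)) :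
    R.Los (.bex x t φ) := by
  intro F hF
  obtain ⟨ht, ht'⟩ := R.exists_tval h hF t
  have hlt : ∀ a b, FuncIn S X a → FuncIn S X b → {i | S.lt (a i) (b i)} ∈ X := by
    intro a b ha hb
    have := glt (fun j => if j = 0 then a else b) (by intro j; split_ifs <;> assumption)
    simpa [Sat0, Sat, tval] using this
  have key := hU.exists_mem_iff h
    (P := fun i y => S.lt y (tval S (fun j => F j i) t) ∧ Sat0 S (upd (fun j => F j i) x y) φ)
    (fun a b ha hb => h.inter_mem (hlt _ _ hb (h.comp_mem ht ha)) (gφ.along h hF x ha hb))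
    (h.id_mem hU.univ_mem') (g F hF)
  refine Iff.trans ?_ key.symm
  refine R.exists_cls.trans ?_
  refine exists_congr fun f => (exists_congr fun hf => ?_).trans exists_prop
  have hv := hφ _ (funcIn_upd hF x hf)
  rw [← R.upd_val hF x hf] at hv
  rw [ht', R.lt_iff]
  refine (and_congr_right fun _ => hv).trans ?_
  simp only [upd_apply_fun]
  refine (hU.inter_mem_iff (hlt _ _ hf ht) ?_).symm
  exact gφ.along h hF x (h.id_mem hU.univ_mem') hf

theorem RUP.Los.ball {R : RUP S X U} (hU : UltraOn S X U) (h : RCA0 S X) {φ : Fml}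
    (hφ : R.Los φ) (gφ : Good S X φ) (glt : Good S X (.lt (.var 0) (.var 1)))
    (x : ℕ) (t : Term) (g : Good S X (.ball x t φ)) : R.Los (.ball x t φ) := by
  have e : ∀ (S : Str) (v : ℕ → S.M),
      Sat0 S v (.bex x t (.not φ)) ↔ Sat0 S v (.not (.ball x t φ)) := by
    intro S v
    simp [Sat0, Sat]
  have g' := (g.not h).of_equiv e
  refine ((RUP.Los.bex hU h (hφ.not hU gφ) (gφ.not h) glt x t g').not hU g').of_equiv ?_
  intro S v
  simp [Sat0, Sat]

theorem RUP.los_delta0 (R : RUP S X U) (hU : UltraOn S X U) (h : RCA0 S X)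
    (hG : ∀ φ, Delta0 φ → Good S X φ) {φ : Fml} (hφ : Delta0 φ) : R.Los φ := by
  induction hφ with
  | eq t u =>
    intro F hF
    obtain ⟨ht, ht'⟩ := R.exists_tval h hF t
    obtain ⟨hu, hu'⟩ := R.exists_tval h hF u
    rw [Sat0, Sat, ht', hu', R.eq_iff]
    rfl
  | lt t u =>
    intro F hF
    obtain ⟨ht, ht'⟩ := R.exists_tval h hF t
    obtain ⟨hu, hu'⟩ := R.exists_tval h hF u
    rw [Sat0, Sat, ht', hu', R.lt_iff]
    rfl
  | not hd ih => exact ih.not hU (hG _ hd)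
  | and hd hd' ih ih' => exact ih.and hU (hG _ hd) ih' (hG _ hd')
  | or hd hd' ih ih' =>
    refine (((ih.not hU (hG _ hd)).and hU (hG _ (.not hd)) (ih'.not hU (hG _ hd'))
      (hG _ (.not hd'))).not hU (hG _ (.and (.not hd) (.not hd')))).of_equiv fun S v => ?_
    simp only [Sat0, Sat]
    tauto
  | imp hd hd' ih ih' =>
    refine ((ih.and hU (hG _ hd) (ih'.not hU (hG _ hd')) (hG _ (.not hd'))).not hU
      (hG _ (.and hd (.not hd')))).of_equiv fun S v => ?_
    simp only [Sat0, Sat]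
    tauto
  | ball x t hd ih => exact ih.ball hU h (hG _ hd) (hG _ (.lt _ _)) x t (hG _ (.ball x t hd))
  | bex x t hd ih => exact ih.bex hU h (hG _ hd) (hG _ (.lt _ _)) x t (hG _ (.bex x t hd))

mutual

theorem RUP.los_isSigma (R : RUP S X U) (hU : UltraOn S X U) (h : RCA0 S X) {n : ℕ}
    (hCA : SigmaCA S X n) {m : ℕ} {φ : Fml} (hφ : IsSigma m φ) :
    m ≤ n → R.Los φ := by
  intro hmn
  match hφ with
  | .delta0 hd =>
    exact R.los_delta0 hU h (fun _ hd => h.good_of_isSigma hU.univ_mem' hCA (.delta0 hd)) hd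
  | .ofPi hp => exact R.los_isPi hU h hCA hp (Nat.le_of_succ_le hmn)
  | .ex x hs =>
    exact (R.los_isSigma hU h hCA hs hmn).ex hU h
      (h.good_of_isSigma hU.univ_mem' hCA (hs.mono hmn)) x
      (h.good_of_isSigma hU.univ_mem' hCA (IsSigma.mono hmn (.ex x hs)))

theorem RUP.los_isPi (R : RUP S X U) (hU : UltraOn S X U) (h : RCA0 S X) {n : ℕ}
    (hCA : SigmaCA S X n) {m : ℕ} {φ : Fml} (hφ : IsPi m φ) :
    m ≤ n → R.Los φ := by
  intro hmn
  match hφ with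
  | .delta0 hd =>
    exact R.los_delta0 hU h (fun _ hd => h.good_of_isSigma hU.univ_mem' hCA (.delta0 hd)) hd
  | .ofSigma hs => exact R.los_isSigma hU h hCA hs (Nat.le_of_succ_le hmn)
  | .all x hp =>
    exact (R.los_isPi hU h hCA hp hmn).all hU h
      (h.good_of_isPi hU.univ_mem' hCA (hp.mono hmn)) x
      (h.good_of_isPi hU.univ_mem' hCA (IsPi.mono hmn (.all x hp)))

end

/-- A `Σₙ₊₁` formula is an existential quantification of a relation that is decided by `X` along
functions of `X`. -/
theorem RCA0.exists_matrix (h : RCA0 S X) (hX : Set.univ ∈ X) {n : ℕ} (hCA : SigmaCA S X n)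
    {φ : Fml} {m : ℕ} (hm : m = n + 1) (hφ : IsSigma m φ) :
    ∃ Q : (ℕ → S.M) → S.M → Prop, (∀ v, Sat0 S v φ ↔ ∃ z, Q v z) ∧
      ∀ (F : ℕ → S.M → S.M) (b : S.M → S.M), (∀ j, FuncIn S X (F j)) → FuncIn S X b →
        {i | Q (fun j => F j i) (b i)} ∈ X := by
  match hφ with
  | .delta0 hd =>
    exact ⟨fun v _ => Sat0 S v φ, fun v => ⟨fun hv => ⟨S.zero, hv⟩, fun ⟨_, hv⟩ => hv⟩,
      fun F _ hF _ => h.good_of_isSigma hX hCA (.delta0 hd) F hF⟩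
  | .ofPi hp =>
    obtain rfl := Nat.succ.inj hm
    exact ⟨fun v _ => Sat0 S v φ, fun v => ⟨fun hv => ⟨S.zero, hv⟩, fun ⟨_, hv⟩ => hv⟩,
      fun F _ hF _ => h.good_of_isPi hX hCA hp F hF⟩
  | .ex x (φ := ψ) hs =>
    obtain ⟨Q, hQ, hQ'⟩ := h.exists_matrix hX hCA hm hs
    obtain ⟨p, q, hp, hq, hpq⟩ := h.exists_proj hX
    refine ⟨fun v z => Q (upd v x (p z)) (q z), fun v => ?_, fun F b hF hb => ?_⟩
    · constructor
      · rintro ⟨y, hy⟩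
        obtain ⟨z, hz⟩ := (hQ _).1 hy
        exact ⟨pairS S y z, by simpa [hpq] using hz⟩
      · rintro ⟨z, hz⟩
        exact ⟨p z, (hQ _).2 ⟨_, hz⟩⟩
    · have := hQ' _ _ (funcIn_upd hF x (h.comp_mem hp hb)) (h.comp_mem hq hb)
      simpa only [upd_apply_fun] using this

/-- One half of Łoś's theorem for `Σₙ₊₁` formulas. -/
theorem RUP.sat_of_subset (R : RUP S X U) (hU : UltraOn S X U) (h : RCA0 S X) {n : ℕ}
    (hCA : SigmaCA S X n) {φ : Fml} {m : ℕ} (hm : m = n + 1) (hφ : IsSigma m φ)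
    {F : ℕ → S.M → S.M} (hF : ∀ j, FuncIn S X (F j)) {A : Set S.M} (hA : A ∈ U)
    (hAφ : ∀ i ∈ A, Sat0 S (fun j => F j i) φ) : Sat0 R.K (R.val hF) φ := by
  match hφ with
  | .delta0 hd =>
    have hs : IsSigma n φ := .delta0 hd
    exact (R.los_isSigma hU h hCA hs le_rfl F hF).2
      (hU.superset_mem _ hA _ (h.good_of_isSigma hU.univ_mem' hCA hs F hF) hAφ)
  | .ofPi hp =>
    obtain rfl := Nat.succ.inj hm
    exact (R.los_isPi hU h hCA hp le_rfl F hF).2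
      (hU.superset_mem _ hA _ (h.good_of_isPi hU.univ_mem' hCA hp F hF) hAφ)
  | .ex x (φ := ψ) hs =>
    obtain ⟨Q, hQ, hQ'⟩ := h.exists_matrix hU.univ_mem' hCA hm hs
    obtain ⟨p, q, hp, hq, hpq⟩ := h.exists_proj hU.univ_mem'
    obtain ⟨g, hg, hg'⟩ := h.exists_choice hU.univ_mem'
      (P := fun i z => Q (upd (fun j => F j i) x (p z)) (q z))
      (fun a b ha hb => by
        have := hQ' _ _ (funcIn_upd (fun j => h.comp_mem (hF j) ha) x (h.comp_mem hp hb))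
          (h.comp_mem hq hb)
        simpa only [upd_apply_fun] using this)
      (hU.subset hA) (fun i hi => by
        obtain ⟨y, hy⟩ := hAφ i hi
        obtain ⟨z, hz⟩ := (hQ _).1 hy
        exact ⟨pairS S y z, by simpa [hpq] using hz⟩)
    have hpg := h.comp_mem hp hg
    refine ⟨R.cls _ hpg, ?_⟩
    rw [R.upd_val]
    refine R.sat_of_subset hU h hCA hm hs _ hA fun i hi => ?_
    rw [upd_apply_fun]
    exact (hQ _).2 ⟨_, hg' i hi⟩

/-- The other half of Łoś's theorem for `Σₙ₊₁` formulas. -/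
theorem RUP.exists_subset_of_sat (R : RUP S X U) (hU : UltraOn S X U) (h : RCA0 S X) {n : ℕ}
    (hCA : SigmaCA S X n) {φ : Fml} {m : ℕ} (hm : m = n + 1) (hφ : IsSigma m φ)
    {F : ℕ → S.M → S.M} (hF : ∀ j, FuncIn S X (F j)) (hs : Sat0 R.K (R.val hF) φ) :
    ∃ A ∈ U, ∀ i ∈ A, Sat0 S (fun j => F j i) φ := by
  match hφ with
  | .delta0 hd =>
    exact ⟨_, (R.los_isSigma hU h hCA (.delta0 hd) le_rfl F hF).1 hs, fun _ hi => hi⟩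
  | .ofPi hp =>
    obtain rfl := Nat.succ.inj hm
    exact ⟨_, (R.los_isPi hU h hCA hp le_rfl F hF).1 hs, fun _ hi => hi⟩
  | .ex x (φ := ψ) hψ =>
    obtain ⟨g, hg, hs⟩ := R.exists_cls.1 hs
    rw [R.upd_val] at hs
    obtain ⟨A, hA, hA'⟩ := R.exists_subset_of_sat hU h hCA hm hψ _ hs
    refine ⟨A, hA, fun i hi => ⟨g i, ?_⟩⟩
    have := hA' i hi
    rwa [upd_apply_fun] at this

/-- A `Πₙ₊₁` formula true in the restricted ultrapower is true at some index. -/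
theorem RUP.exists_sat_of_sat_isPi (R : RUP S X U) (hU : UltraOn S X U) (h : RCA0 S X) {n : ℕ}
    (hCA : SigmaCA S X n) {φ : Fml} (hφ : IsPi (n + 1) φ)
    {F : ℕ → S.M → S.M} (hF : ∀ j, FuncIn S X (F j)) (hs : Sat0 R.K (R.val hF) φ) :
    ∃ i, Sat0 S (fun j => F j i) φ := by
  by_contra! H
  obtain ⟨ψ, hψ, hψ'⟩ := hφ.exists_neg
  exact (hψ' _ _).1 (R.sat_of_subset hU h hCA rfl hψ hF hU.univ_mem
    fun i _ => (hψ' _ _).2 (H i)) hs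

/-- A `Σₙ₊₂` formula true in the restricted ultrapower is true at some index. -/
theorem RUP.exists_sat_of_sat (R : RUP S X U) (hU : UltraOn S X U) (h : RCA0 S X) {n : ℕ}
    (hCA : SigmaCA S X n) {φ : Fml} {m : ℕ} (hm : m = n + 2) (hφ : IsSigma m φ)
    {F : ℕ → S.M → S.M} (hF : ∀ j, FuncIn S X (F j)) (hs : Sat0 R.K (R.val hF) φ) :
    ∃ i, Sat0 S (fun j => F j i) φ := by
  match hφ with
  | .delta0 hd => exact R.exists_sat_of_sat_isPi hU h hCA (.delta0 hd) hF hs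
  | .ofPi hp =>
    obtain rfl := Nat.succ.inj hm
    exact R.exists_sat_of_sat_isPi hU h hCA hp hF hs
  | .ex x (φ := ψ) hψ =>
    obtain ⟨g, hg, hs⟩ := R.exists_cls.1 hs
    rw [R.upd_val] at hs
    obtain ⟨i, hi⟩ := R.exists_sat_of_sat hU h hCA hm hψ _ hs
    rw [upd_apply_fun] at hi
    exact ⟨i, g i, hi⟩

theorem RUP.sat_emb_of_sat_isPi (R : RUP S X U) (hU : UltraOn S X U) (h : RCA0 S X) {n : ℕ}
    (hCA : SigmaCA S X n) {φ : Fml} (hφ : IsPi (n + 1) φ) (v : ℕ → S.M) (hs : Sat0 S v φ) :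
    Sat0 R.K (fun k => R.emb (v k)) φ := by
  by_contra H
  obtain ⟨ψ, hψ, hψ'⟩ := hφ.exists_neg
  obtain ⟨A, hA, hA'⟩ := R.exists_subset_of_sat hU h hCA rfl hψ (F := fun k _ => v k)
    (fun k => R.const_in (v k)) ((hψ' _ _).2 H)
  obtain ⟨i, hi, -⟩ := hU.cofinal A hA S.zero
  exact (hψ' _ _).1 (hA' i hi) hs

theorem RUP.sat_emb_of_sat (R : RUP S X U) (hU : UltraOn S X U) (h : RCA0 S X) {n : ℕ}
    (hCA : SigmaCA S X n) {φ : Fml} {m : ℕ} (hm : m = n + 2) (hφ : IsSigma m φ)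
    (v : ℕ → S.M) (hs : Sat0 S v φ) : Sat0 R.K (fun k => R.emb (v k)) φ := by
  match hφ with
  | .delta0 hd => exact R.sat_emb_of_sat_isPi hU h hCA (.delta0 hd) v hs
  | .ofPi hp =>
    obtain rfl := Nat.succ.inj hm
    exact R.sat_emb_of_sat_isPi hU h hCA hp v hs
  | .ex x (φ := ψ) hψ =>
    obtain ⟨a, ha⟩ := hs
    refine ⟨R.emb a, ?_⟩
    have := R.sat_emb_of_sat hU h hCA hm hψ _ ha
    have e : upd (fun k => R.emb (v k)) x (R.emb a) = fun k => R.emb (upd v x a k) := by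
      funext k
      unfold upd
      split_ifs <;> rfl
    rw [← e] at this
    exact this

end Los

/-- Corollary `cor:1stele`.
Let `(M, 𝒳) ⊨ RCA₀`, `ℱ` the class of total functions `M → M` in `𝒳`, and
`𝒰` an ultrafilter on `𝒳` all of whose elements are cofinal in `M`.  For
`n ∈ ℕ`, if `(M, 𝒳)` satisfies `Σₙ`-comprehension, then `M ≼_{Σₙ₊₂} ℱ/𝒰`
as models of first-order arithmetic. -/
theorem statement_5 (S : Str) (X U : Set (Set S.M))
    (hRCA : RCA0 S X) (hU : UltraOn S X U) (R : RUP S X U)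
    (n : ℕ) (hCA : SigmaCA S X n) :
    ∀ φ : Fml, IsSigma (n + 2) φ →
      ∀ v : ℕ → S.M, (Sat0 S v φ ↔ Sat0 R.K (fun k => R.emb (v k)) φ) := by
  intro φ hφ v
  constructor
  · exact R.sat_emb_of_sat hU hRCA hCA rfl hφ v
  · intro hs
    obtain ⟨_, hi⟩ := R.exists_sat_of_sat hU hRCA hCA rfl hφ (fun k => R.const_in (v k)) hs
    exact hi

end PaperArith
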